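/- Let m ≥ 1, n ≥ 0, N ≥ 1, ρ_1 > 0. Let Ω ⊆ ℂ^n be open and bounded and let Ω_1 be an open neighbourhood of the closure of Ω. Let p ∈ ℂ[s] be monic of degree m with p(k) ≠ 0 for every integer k ≥ 0. For every pair of indices i, l ∈ {1,…,N}, every multi-index α ∈ ℕ^n and integer j ≥ 0 with |α| + j ≤ m, let a^{(i,l)}_{α,j} be a holomorphic function on D_{ρ_1} × Ω_1. Define, for ℂ^N-valued holomorphic u = (u_1,…,u_N) on an open subset of ℂ × ℂ^n, (Pu)_i(t,x) = p(θ_t)u_i(t,x) + t·∑_{l=1}^N ∑_{|α|+j ≤ m} a^{(i,l)}_{α,j}(t,x)·∂_x^α θ_t^j u_l(t,x). Then there exists ρ ∈ (0, ρ_1) with the following property: for every open set ω ⊆ D_ρ that is star-shaped with respect to the origin and every holomorphic f : ω × Ω_1 → ℂ^N, there exists a unique holomorphic u : ω × Ω → ℂ^N satisfying Pu = f on ω × Ω. -/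

import Mathlib

open MeasureTheory Polynomial

/-- The Euler operator in the variable `t`: `(θ_t u)(t,x) = t·∂_t u(t,x)`. -/
noncomputable def thetaT {n : ℕ} (u : ℂ → (Fin n → ℂ) → ℂ) : ℂ → (Fin n → ℂ) → ℂ :=
  fun t x => t * deriv (fun τ => u τ x) t

/-- The partial derivative `∂_{x_k}` in the variables `x ∈ ℂ^n`. -/
noncomputable def partialX {n : ℕ} (k : Fin n) (u : ℂ → (Fin n → ℂ) → ℂ) :
    ℂ → (Fin n → ℂ) → ℂ :=
  fun t x => deriv (fun z => u t (Function.update x k z)) (x k)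

/-- The iterated partial derivative `∂_x^α = ∂_{x_1}^{α_1}⋯∂_{x_n}^{α_n}`. -/
noncomputable def partialPow {n : ℕ} (α : Fin n → ℕ) (u : ℂ → (Fin n → ℂ) → ℂ) :
    ℂ → (Fin n → ℂ) → ℂ :=
  (List.finRange n).foldr (fun k v => (partialX k)^[α k] v) u

/-- The `i`-th component of the Fuchsian type `N×N`-system
`(Pu)_i = p(θ_t)u_i + t·∑_l ∑_{|α|+j ≤ m} a^{(i,l)}_{α,j}·∂_x^α θ_t^j u_l`. -/
noncomputable def fuchsSysOp {n N : ℕ} (m : ℕ) (p : Polynomial ℂ)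
    (a : Fin N → Fin N → (Fin n → ℕ) → ℕ → ℂ → (Fin n → ℂ) → ℂ)
    (u : Fin N → ℂ → (Fin n → ℂ) → ℂ) (i : Fin N) :
    ℂ → (Fin n → ℂ) → ℂ := fun t x =>
  (∑ j ∈ Finset.range (p.natDegree + 1), p.coeff j * (thetaT^[j] (u i)) t x)
    + t * ∑ l : Fin N, ∑ j ∈ Finset.range (m + 1),
        ∑ α ∈ Fintype.piFinset (fun _ : Fin n => Finset.range (m + 1)),
          if (∑ k, α k) + j ≤ m then
            a i l α j t x * (partialPow α (thetaT^[j] (u l))) t x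
          else 0

section SolvabilityProof

open Metric Set Filter Topology Interval
open TopologicalSpace (Opens)

section SeveralVariables

variable {E : Type*} [NormedAddCommGroup E] [NormedSpace ℂ E]

lemma norm_fderiv_le_of_norm_le_ball {F : E → ℂ} {c : E} {R M : ℝ} (hR : 0 < R)
    (hd : DifferentiableOn ℂ F (ball c R)) (hM : ∀ y ∈ ball c R, ‖F y‖ ≤ M) :
    ‖fderiv ℂ F c‖ ≤ 2 * M / R := by
  refine Complex.norm_fderiv_le_div_of_mapsTo_ball hd (fun y hy => ?_) hR
  rw [mem_closedBall, dist_eq_norm]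
  have h1 := hM y hy
  have h2 := hM c (mem_ball_self hR)
  linarith [norm_sub_le (F y) (F c)]

lemma exists_bound_near_compact [FiniteDimensional ℂ E] {W K : Set E} (hW : IsOpen W)
    (hK : IsCompact K) (hKW : K ⊆ W) {F : E → ℂ} (hF : DifferentiableOn ℂ F W) :
    ∃ δ > 0, ∃ M : ℝ, thickening δ K ⊆ W ∧
      ∀ y ∈ thickening δ K, ‖F y‖ ≤ M ∧ ‖fderiv ℂ F y‖ ≤ M := by
  have := FiniteDimensional.proper ℂ E
  obtain ⟨δ, hδ, hsub⟩ := hK.exists_cthickening_subset_open hW hKW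
  obtain ⟨M, hM⟩ := (hK.cthickening (r := δ)).exists_bound_of_continuousOn (hF.continuousOn.mono hsub)
  have hball : ∀ y ∈ thickening (δ / 2) K, ball y (δ / 2) ⊆ cthickening δ K := by
    intro y hy z hz
    obtain ⟨x, hx, hxy⟩ := mem_thickening_iff.1 hy
    refine thickening_subset_cthickening _ _ (mem_thickening_iff.2 ⟨x, hx, ?_⟩)
    have := dist_triangle z y x
    rw [mem_ball] at hz
    linarith
  have hself : ∀ y ∈ thickening (δ / 2) K, y ∈ cthickening δ K := fun y hy =>
    hball y hy (mem_ball_self (half_pos hδ))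
  refine ⟨δ / 2, half_pos hδ, max M (2 * M / (δ / 2)), fun y hy => hsub (hself y hy), ?_⟩
  intro y hy
  refine ⟨(hM y (hself y hy)).trans (le_max_left _ _), le_trans ?_ (le_max_right _ _)⟩
  exact norm_fderiv_le_of_norm_le_ball (half_pos hδ) (hF.mono ((hball y hy).trans hsub))
    fun z hz => hM z (hball y hy hz)

/-- Holomorphic dependence on `y` of `∫ φ(σ) F(A(σ) y + c(σ)) dσ`. -/
lemma differentiableOn_integral_comp_affine [FiniteDimensional ℂ E] {W V : Set E} (hW : IsOpen W)
    {F : E → ℂ} (hF : DifferentiableOn ℂ F W) {φ : ℝ → ℂ} (hφ : Continuous φ)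
    {A : ℝ → E →L[ℂ] E} (hA : Continuous A) {c : ℝ → E} (hc : Continuous c) {a b : ℝ} (hab : a ≤ b)
    (hV : ∀ y ∈ V, ∀ σ ∈ Icc a b, A σ y + c σ ∈ W) :
    DifferentiableOn ℂ (fun y => ∫ σ in a..b, φ σ * F (A σ y + c σ)) V := by
  have := FiniteDimensional.proper ℂ E
  have := FiniteDimensional.proper ℂ (E →L[ℂ] ℂ)
  borelize E
  intro y₀ hy₀
  apply DifferentiableAt.differentiableWithinAt
  set K : Set E := (fun σ => A σ y₀ + c σ) '' Icc a b with hKdef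
  have hcurve : ∀ y, Continuous (fun σ => A σ y + c σ) := fun y => by fun_prop
  have hK : IsCompact K := isCompact_Icc.image (hcurve y₀)
  have hKW : K ⊆ W := by
    rintro _ ⟨σ, hσ, rfl⟩
    exact hV y₀ hy₀ σ hσ
  obtain ⟨δ, hδ, M, hsub, hM⟩ := exists_bound_near_compact hW hK hKW hF
  obtain ⟨B, hB⟩ := isCompact_Icc.exists_bound_of_continuousOn (s := Icc a b) hA.continuousOn
  obtain ⟨Cφ, hCφ⟩ := isCompact_Icc.exists_bound_of_continuousOn (s := Icc a b) hφ.continuousOn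
  have hB' : 0 < |B| + 1 := by positivity
  have hnear : ∀ y ∈ ball y₀ (δ / (|B| + 1)), ∀ σ ∈ Icc a b, A σ y + c σ ∈ thickening δ K := by
    intro y hy σ hσ
    refine mem_thickening_iff.2 ⟨A σ y₀ + c σ, ⟨σ, hσ, rfl⟩, ?_⟩
    rw [dist_add_right, dist_eq_norm, ← map_sub]
    rw [mem_ball, dist_eq_norm, lt_div_iff₀ hB'] at hy
    have h1 := (A σ).le_opNorm (y - y₀)
    have h2 : ‖A σ‖ ≤ |B| + 1 := (hB σ hσ).trans (by linarith [le_abs_self B])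
    nlinarith [mul_le_mul_of_nonneg_right h2 (norm_nonneg (y - y₀))]
  have hIoc : Ι a b = Ioc a b := uIoc_of_le hab
  have hcont : ∀ y ∈ ball y₀ (δ / (|B| + 1)),
      ContinuousOn (fun σ => φ σ * F (A σ y + c σ)) (Icc a b) := by
    intro y hy
    refine hφ.continuousOn.mul ?_
    exact hF.continuousOn.comp (hcurve y).continuousOn fun σ hσ => hsub (hnear y hy σ hσ)
  have hs : ball y₀ (δ / (|B| + 1)) ∈ 𝓝 y₀ := ball_mem_nhds _ (by positivity)
  refine (intervalIntegral.hasFDerivAt_integral_of_dominated_of_fderiv_le (μ := volume) (𝕜 := ℂ)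
    (F := fun y σ => φ σ * F (A σ y + c σ))
    (F' := fun y σ => φ σ • (fderiv ℂ F (A σ y + c σ)).comp (A σ))
    (bound := fun _ => |Cφ| * (|M| * |B|)) hs ?_ ?_ ?_ ?_ ?_ ?_).differentiableAt
  · filter_upwards [hs] with y hy
    rw [hIoc]
    exact ((hcont y hy).mono Ioc_subset_Icc_self).aestronglyMeasurable measurableSet_Ioc
  · refine ContinuousOn.intervalIntegrable ?_
    rw [uIcc_of_le hab]
    exact hcont y₀ (mem_of_mem_nhds hs)
  · refine Measurable.aestronglyMeasurable ?_
    have h1 : Measurable (fun σ => fderiv ℂ F (A σ y₀ + c σ)) :=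
      (measurable_fderiv ℂ F).comp (hcurve y₀).measurable
    have h2 : Continuous fun p : (E →L[ℂ] ℂ) × (E →L[ℂ] E) => p.1.comp p.2 := by fun_prop
    exact hφ.measurable.smul (h2.measurable.comp (h1.prodMk hA.measurable))
  · refine Eventually.of_forall fun σ hσ y hy => ?_
    rw [hIoc] at hσ
    have hσ' := Ioc_subset_Icc_self hσ
    rw [norm_smul]
    refine mul_le_mul ((hCφ σ hσ').trans (le_abs_self _)) ?_ (norm_nonneg _) (abs_nonneg _)
    refine (ContinuousLinearMap.opNorm_comp_le _ _).trans ?_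
    exact mul_le_mul ((hM _ (hnear y hy σ hσ')).2.trans (le_abs_self _))
      ((hB σ hσ').trans (le_abs_self _)) (norm_nonneg _) (abs_nonneg _)
  · exact intervalIntegrable_const
  · refine Eventually.of_forall fun σ hσ y hy => ?_
    rw [hIoc] at hσ
    have hmem := hsub (hnear y hy σ (Ioc_subset_Icc_self hσ))
    have h1 : HasFDerivAt F (fderiv ℂ F (A σ y + c σ)) (A σ y + c σ) :=
      ((hF _ hmem).differentiableAt (hW.mem_nhds hmem)).hasFDerivAt
    have h2 : HasFDerivAt (fun y => A σ y + c σ) (A σ) y := (A σ).hasFDerivAt.add_const _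
    simpa using (h1.comp y h2).const_mul (φ σ)

lemma hasDerivAt_comp_line {F : E → ℂ} {q v : E} {s : ℂ}
    (hF : DifferentiableAt ℂ F (q + s • v)) :
    HasDerivAt (fun s : ℂ => F (q + s • v)) (fderiv ℂ F (q + s • v) v) s := by
  have h : HasDerivAt (fun s : ℂ => q + s • v) v s := by
    simpa using ((hasDerivAt_id s).smul_const v).const_add q
  exact hF.hasFDerivAt.comp_hasDerivAt s h

lemma fderiv_apply_eq_deriv {F : E → ℂ} {q : E} (v : E) (hF : DifferentiableAt ℂ F q) :
    fderiv ℂ F q v = deriv (fun s : ℂ => F (q + s • v)) 0 := by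
  have := hasDerivAt_comp_line (F := F) (q := q) (v := v) (s := 0) (by simpa using hF)
  simpa using this.deriv.symm

/-- Directional derivatives of holomorphic functions are holomorphic. -/
lemma differentiableOn_fderiv_apply [FiniteDimensional ℂ E] {W : Set E} (hW : IsOpen W)
    {F : E → ℂ} (hF : DifferentiableOn ℂ F W) (v : E) :
    DifferentiableOn ℂ (fun q => fderiv ℂ F q v) W := by
  intro q₀ hq₀
  apply DifferentiableAt.differentiableWithinAt
  obtain ⟨r, hr, hrW⟩ := Metric.isOpen_iff.1 hW q₀ hq₀
  set R : ℝ := r / 2 / (‖v‖ + 1) with hRdef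
  have hv : 0 < ‖v‖ + 1 := by positivity
  have hR : 0 < R := by positivity
  have hRv : R * ‖v‖ < r / 2 := by
    have : R * (‖v‖ + 1) = r / 2 := by rw [hRdef]; field_simp
    nlinarith
  have hmem : ∀ q ∈ ball q₀ (r / 2), ∀ s : ℂ, ‖s‖ ≤ R → q + s • v ∈ W := by
    intro q hq s hs
    apply hrW
    rw [mem_ball, dist_eq_norm] at hq ⊢
    have h1 : ‖s • v‖ ≤ R * ‖v‖ := by
      rw [norm_smul]; exact mul_le_mul_of_nonneg_right hs (norm_nonneg _)
    calc ‖q + s • v - q₀‖ = ‖(q - q₀) + s • v‖ := by congr 1; abel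
      _ ≤ ‖q - q₀‖ + ‖s • v‖ := norm_add_le _ _
      _ < r := by linarith
  have hdiff : ∀ q ∈ ball q₀ (r / 2), ∀ s : ℂ, ‖s‖ ≤ R →
      DifferentiableAt ℂ (fun s : ℂ => F (q + s • v)) s := by
    intro q hq s hs
    have h := hmem q hq s hs
    exact (hasDerivAt_comp_line ((hF _ h).differentiableAt (hW.mem_nhds h))).differentiableAt
  have hint := differentiableOn_integral_comp_affine (V := ball q₀ (r / 2)) hW hF
    (φ := fun θ => (2 * Real.pi * Complex.I)⁻¹ * (deriv (circleMap 0 R) θ * (circleMap 0 R θ ^ 2)⁻¹))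
    (by
      have h0 : ∀ θ, circleMap 0 R θ ^ 2 ≠ 0 := fun θ =>
        pow_ne_zero _ (circleMap_ne_center hR.ne')
      have h1 : Continuous (circleMap 0 R) := continuous_circleMap 0 R
      have h2 : Continuous (fun θ => deriv (circleMap 0 R) θ) := by
        simp only [deriv_circleMap]; fun_prop
      exact continuous_const.mul (h2.mul ((h1.pow 2).inv₀ h0)))
    (A := fun _ => ContinuousLinearMap.id ℂ E) continuous_const
    (c := fun θ => circleMap 0 R θ • v) (by fun_prop) (a := 0) (b := 2 * Real.pi)
    Real.two_pi_pos.le (fun q hq θ _ => hmem q hq _ (by simp [abs_of_pos hR]))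
  refine (((hint q₀ (mem_ball_self (half_pos hr))).differentiableAt
    (ball_mem_nhds _ (half_pos hr))).congr_of_eventuallyEq ?_)
  filter_upwards [ball_mem_nhds q₀ (half_pos hr)] with q hq
  have hqW : q ∈ W := by simpa using hmem q hq 0 (by simpa using hR.le)
  rw [fderiv_apply_eq_deriv v ((hF q hqW).differentiableAt (hW.mem_nhds hqW))]
  have hd : DiffContOnCl ℂ (fun s : ℂ => F (q + s • v)) (ball 0 R) := by
    refine DifferentiableOn.diffContOnCl fun s hs => ?_
    rw [closure_ball _ hR.ne', mem_closedBall, dist_zero_right] at hs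
    exact (hdiff q hq s hs).differentiableWithinAt
  have hcauchy := hd.circleIntegral_one_div_sub_center_pow_smul hR 1
  simp only [circleIntegral, Nat.factorial_one, Nat.cast_one, div_one, iteratedDeriv_one, sub_zero,
    smul_eq_mul, one_div, one_add_one_eq_two] at hcauchy
  have h2pi : (2 * Real.pi * Complex.I : ℂ) ≠ 0 := Complex.two_pi_I_ne_zero
  rw [← inv_mul_cancel_left₀ h2pi (deriv _ _), ← hcauchy, ← intervalIntegral.integral_const_mul]
  simp only [ContinuousLinearMap.id_apply, mul_assoc]

end SeveralVariables

section HolomorphicSpace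

variable {E : Type*} [NormedAddCommGroup E] [NormedSpace ℂ E]

/-- The space of holomorphic functions on an open set, extended by zero outside of it. -/
def Hol (W : Opens E) : Submodule ℂ (E → ℂ) where
  carrier := {F | DifferentiableOn ℂ F W ∧ ∀ q ∉ W, F q = 0}
  add_mem' hF hG := ⟨hF.1.add hG.1, fun q hq => by simp [hF.2 q hq, hG.2 q hq]⟩
  zero_mem' := ⟨differentiableOn_const 0, fun _ _ => rfl⟩
  smul_mem' c _ hF := ⟨hF.1.const_smul c, fun q hq => by simp [hF.2 q hq]⟩

namespace Hol

variable {W W' : Opens E}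

lemma diffOn (F : Hol W) : DifferentiableOn ℂ F.1 W := F.2.1

lemma diffAt (F : Hol W) {q : E} (hq : q ∈ W) : DifferentiableAt ℂ F.1 q :=
  ((diffOn F) q hq).differentiableAt (W.isOpen.mem_nhds hq)

lemma ext_on {F G : Hol W} (h : ∀ q ∈ W, F.1 q = G.1 q) : F = G := by
  refine Subtype.ext (funext fun q => ?_)
  by_cases hq : q ∈ W
  · exact h q hq
  · rw [F.2.2 q hq, G.2.2 q hq]

@[simp] lemma add_val (F G : Hol W) (q : E) : (F + G).1 q = F.1 q + G.1 q := rfl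

@[simp] lemma sub_val (F G : Hol W) (q : E) : (F - G).1 q = F.1 q - G.1 q := rfl

@[simp] lemma neg_val (F : Hol W) (q : E) : (-F).1 q = -F.1 q := rfl

@[simp] lemma smul_val (c : ℂ) (F : Hol W) (q : E) : (c • F).1 q = c * F.1 q := rfl

@[simp] lemma zero_val (q : E) : (0 : Hol W).1 q = 0 := rfl

@[simp] lemma sum_val {ι : Type*} (s : Finset ι) (F : ι → Hol W) (q : E) :
    (∑ i ∈ s, F i).1 q = ∑ i ∈ s, (F i).1 q := by
  classical
  induction s using Finset.induction_on with
  | empty => simp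
  | insert i s hi ih => simp [Finset.sum_insert hi, ih]

open Classical in
/-- A function holomorphic on `W`, cut off outside of `W`. -/
noncomputable def ofFun (F : E → ℂ) (hF : DifferentiableOn ℂ F W) : Hol W :=
  ⟨fun q => if q ∈ W then F q else 0, hF.congr fun _ hq => if_pos hq, fun _ hq => if_neg hq⟩

lemma ofFun_val {F : E → ℂ} (hF : DifferentiableOn ℂ F W) {q : E} (hq : q ∈ W) :
    (ofFun F hF).1 q = F q := if_pos hq

/-- Restriction to a smaller open set. -/
noncomputable def res (h : W' ≤ W) : Hol W →ₗ[ℂ] Hol W' where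
  toFun F := ofFun F.1 ((diffOn F).mono h)
  map_add' F G := ext_on fun q hq => by simp [ofFun_val _ hq]
  map_smul' c F := ext_on fun q hq => by simp [ofFun_val _ hq]

lemma res_val (h : W' ≤ W) (F : Hol W) {q : E} (hq : q ∈ W') : (res h F).1 q = F.1 q :=
  ofFun_val ((diffOn F).mono h) hq

open Classical in
/-- Multiplication by a holomorphic function. -/
noncomputable def mul (W : Opens E) (a : E → ℂ) : Module.End ℂ (Hol W) :=
  if ha : DifferentiableOn ℂ a W then
    { toFun := fun F => ⟨fun q => a q * F.1 q, ha.mul (diffOn F), fun q hq => by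
        simp [F.2.2 q hq]⟩
      map_add' := fun F G => ext_on fun q _ => mul_add _ _ _
      map_smul' := fun c F => ext_on fun q _ => mul_left_comm _ _ _ }
  else 0

lemma mul_val {a : E → ℂ} (ha : DifferentiableOn ℂ a W) (F : Hol W) (q : E) :
    (mul W a F).1 q = a q * F.1 q := by
  rw [mul, dif_pos ha]; rfl

lemma res_mul (h : W' ≤ W) {a : E → ℂ} (ha : DifferentiableOn ℂ a W) (F : Hol W) :
    res h (mul W a F) = mul W' a (res h F) :=
  ext_on fun q hq => by
    rw [res_val h _ hq, mul_val ha, mul_val (ha.mono h), res_val h _ hq]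

/-- Locally uniform convergence to zero. -/
def IsNull (R : ℕ → Hol W) : Prop :=
  ∀ q ∈ W, ∃ r > 0, ball q r ⊆ W ∧ ∀ ε > 0, ∀ᶠ k in atTop, ∀ y ∈ ball q r, ‖(R k).1 y‖ ≤ ε

lemma IsNull.tendsto {R : ℕ → Hol W} (hR : IsNull R) {q : E} (hq : q ∈ W) :
    Tendsto (fun k => (R k).1 q) atTop (𝓝 0) := by
  obtain ⟨r, hr, -, h⟩ := hR q hq
  rw [Metric.tendsto_nhds]
  intro ε hε
  filter_upwards [h (ε / 2) (half_pos hε)] with k hk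
  rw [dist_zero_right]
  linarith [hk q (mem_ball_self hr)]

lemma IsNull.add {R S : ℕ → Hol W} (hR : IsNull R) (hS : IsNull S) :
    IsNull fun k => R k + S k := by
  intro q hq
  obtain ⟨r, hr, hrW, h⟩ := hR q hq
  obtain ⟨s, hs, -, h'⟩ := hS q hq
  refine ⟨min r s, lt_min hr hs, (ball_subset_ball (min_le_left _ _)).trans hrW, fun ε hε => ?_⟩
  filter_upwards [h (ε / 2) (half_pos hε), h' (ε / 2) (half_pos hε)] with k hk hk' y hy
  have h1 := hk y (ball_subset_ball (min_le_left _ _) hy)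
  have h2 := hk' y (ball_subset_ball (min_le_right _ _) hy)
  rw [add_val]
  linarith [norm_add_le ((R k).1 y) ((S k).1 y)]

lemma IsNull.mul {R : ℕ → Hol W} (hR : IsNull R) (a : E → ℂ) :
    IsNull fun k => mul W a (R k) := by
  by_cases ha : DifferentiableOn ℂ a W
  · intro q hq
    obtain ⟨r, hr, hrW, h⟩ := hR q hq
    have hcont : ContinuousAt a q := ha.continuousOn.continuousAt (W.isOpen.mem_nhds hq)
    obtain ⟨s, hs, hsa⟩ := Metric.eventually_nhds_iff_ball.1
      (hcont.norm.eventually (gt_mem_nhds (lt_add_one ‖a q‖)))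
    refine ⟨min r s, lt_min hr hs, (ball_subset_ball (min_le_left _ _)).trans hrW, fun ε hε => ?_⟩
    have hpos : 0 < ‖a q‖ + 1 := by positivity
    filter_upwards [h (ε / (‖a q‖ + 1)) (by positivity)] with k hk y hy
    have h1 := hk y (ball_subset_ball (min_le_left _ _) hy)
    have h2 := hsa y (ball_subset_ball (min_le_right _ _) hy)
    rw [mul_val ha, norm_mul]
    calc ‖a y‖ * ‖(R k).1 y‖ ≤ (‖a q‖ + 1) * (ε / (‖a q‖ + 1)) := by gcongr
      _ = ε := by field_simp
  · have : Hol.mul W a = 0 := by rw [Hol.mul, dif_neg ha]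
    intro q hq
    obtain ⟨r, hr, hrW, -⟩ := hR q hq
    exact ⟨r, hr, hrW, fun ε hε => Eventually.of_forall fun k y _ => by simp [this, hε.le]⟩

/-- A locally geometrically bounded series of holomorphic functions has a holomorphic sum. -/
lemma exists_sum (w : ℕ → Hol W)
    (hw : ∀ q ∈ W, ∃ r > 0, ball q r ⊆ W ∧ ∃ M : ℝ, ∀ k, ∀ y ∈ ball q r,
      ‖(w k).1 y‖ ≤ M * (1 / 2) ^ k) :
    ∃ u : Hol W, IsNull fun n => u - ∑ k ∈ Finset.range n, w k := by
  have hsum : ∀ q ∈ W, Summable fun k => (w k).1 q := by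
    intro q hq
    obtain ⟨r, hr, -, M, hM⟩ := hw q hq
    exact Summable.of_norm_bounded
      ((summable_geometric_of_lt_one (by norm_num) (by norm_num)).mul_left M)
      fun k => hM k q (mem_ball_self hr)
  have hdiff : DifferentiableOn ℂ (fun q => ∑' k, (w k).1 q) W := by
    intro q hq
    obtain ⟨r, hr, hrW, M, hM⟩ := hw q hq
    have hsub : ∀ y ∈ ball q (r / 2), ball y (r / 2) ⊆ ball q r := fun y hy =>
      ball_subset_ball' (by rw [mem_ball] at hy; linarith)
    have hu : Summable fun k : ℕ => 2 * (M * (1 / 2) ^ k) / (r / 2) :=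
      ((((summable_geometric_of_lt_one (r := (1 / 2 : ℝ)) (by norm_num)
        (by norm_num)).mul_left M).mul_left 2).div_const _)
    have hq' : q ∈ ball q (r / 2) := mem_ball_self (half_pos hr)
    have := NormedSpace.restrictScalars ℝ ℂ E
    refine (hasFDerivAt_tsum_of_isPreconnected (𝕜 := ℂ) (f := fun k => (w k).1)
      (f' := fun k y => fderiv ℂ (w k).1 y) hu isOpen_ball
      (convex_ball (E := E) q (r / 2)).isPreconnected ?_ ?_ hq' (hsum q hq)
      hq').differentiableAt.differentiableWithinAt
    · intro k y hy
      exact ((diffAt (w k))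
        (hrW (hsub y hy (mem_ball_self (half_pos hr))))).hasFDerivAt
    · intro k y hy
      exact norm_fderiv_le_of_norm_le_ball (half_pos hr)
        ((diffOn (w k)).mono ((hsub y hy).trans hrW)) fun z hz => hM k z (hsub y hy hz)
  refine ⟨ofFun _ hdiff, fun q hq => ?_⟩
  obtain ⟨r, hr, hrW, M, hM⟩ := hw q hq
  refine ⟨r, hr, hrW, fun ε hε => ?_⟩
  have hlim : Tendsto (fun k : ℕ => M * (1 / 2 : ℝ) ^ k / (1 - 1 / 2)) atTop (𝓝 0) := by
    simpa using ((tendsto_pow_atTop_nhds_zero_of_lt_one (r := (1 / 2 : ℝ)) (by norm_num)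
      (by norm_num)).const_mul M).div_const (1 - 1 / 2)
  filter_upwards [hlim.eventually (gt_mem_nhds hε)] with k hk y hy
  have h1 := norm_sub_le_of_geometric_bound_of_hasSum (r := 1 / 2) (by norm_num)
    (fun k => hM k y hy) (hsum y (hrW hy)).hasSum k
  rw [sub_val, sum_val, ofFun_val _ (hrW hy), norm_sub_rev]
  exact h1.trans hk.le

/-- The endomorphisms preserving locally uniform convergence to zero. -/
def nullPreserving (W : Opens E) : Subalgebra ℂ (Module.End ℂ (Hol W)) where
  carrier := {T | ∀ R : ℕ → Hol W, IsNull R → IsNull fun k => T (R k)}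
  mul_mem' hS hT R hR := hS _ (hT R hR)
  add_mem' hS hT R hR := (hS R hR).add (hT R hR)
  algebraMap_mem' c R hR := by
    have h := hR.mul (fun _ => c)
    have h2 : ∀ F : Hol W, Hol.mul W (fun _ => c) F = c • F := fun F => ext_on fun q _ =>
      mul_val (differentiableOn_const c) F q
    simpa [h2, Module.algebraMap_end_apply] using h

lemma mul_mem_nullPreserving (a : E → ℂ) : mul W a ∈ nullPreserving W := fun _ hR => hR.mul a

variable [FiniteDimensional ℂ E]

/-- The derivative in the direction `v`. -/
noncomputable def dir (W : Opens E) (v : E) : Module.End ℂ (Hol W) where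
  toFun F := ofFun (fun q => fderiv ℂ F.1 q v)
    (differentiableOn_fderiv_apply W.isOpen (diffOn F) v)
  map_add' F G := ext_on fun q hq => by
    have : (F + G).1 = F.1 + G.1 := rfl
    simp [ofFun_val _ hq, this, fderiv_add (diffAt F hq) (diffAt G hq)]
  map_smul' c F := ext_on fun q hq => by
    have : (c • F).1 = c • F.1 := rfl
    simp [ofFun_val _ hq, this, fderiv_const_smul (diffAt F hq)]

lemma dir_val (v : E) (F : Hol W) {q : E} (hq : q ∈ W) :
    (dir W v F).1 q = fderiv ℂ F.1 q v :=
  ofFun_val (differentiableOn_fderiv_apply W.isOpen (diffOn F) v) hq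

lemma dir_val_eq_deriv (v : E) (F : Hol W) {q : E} (hq : q ∈ W) :
    (dir W v F).1 q = deriv (fun s : ℂ => F.1 (q + s • v)) 0 := by
  rw [dir_val v F hq, fderiv_apply_eq_deriv v (diffAt F hq)]

lemma res_dir (h : W' ≤ W) (v : E) (F : Hol W) : res h (dir W v F) = dir W' v (res h F) :=
  ext_on fun q hq => by
    rw [res_val h _ hq, dir_val v _ (h hq), dir_val v _ hq]
    congr 1
    refine Filter.EventuallyEq.fderiv_eq ?_
    filter_upwards [W'.isOpen.mem_nhds hq] with y hy
    rw [res_val h F hy]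

lemma IsNull.dir {R : ℕ → Hol W} (hR : IsNull R) (v : E) : IsNull fun k => dir W v (R k) := by
  intro q hq
  obtain ⟨r, hr, hrW, h⟩ := hR q hq
  have hsub : ∀ y ∈ ball q (r / 2), ball y (r / 2) ⊆ ball q r := fun y hy =>
    ball_subset_ball' (by rw [mem_ball] at hy; linarith)
  refine ⟨r / 2, half_pos hr, (ball_subset_ball (by linarith)).trans hrW, fun ε hε => ?_⟩
  have hv : 0 < ‖v‖ + 1 := by positivity
  filter_upwards [h (ε * (r / 2) / 2 / (‖v‖ + 1)) (by positivity)] with k hk y hy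
  have hyW : y ∈ W := hrW (hsub y hy (mem_ball_self (half_pos hr)))
  rw [dir_val v _ hyW]
  have h1 := norm_fderiv_le_of_norm_le_ball (half_pos hr)
    ((diffOn (R k)).mono ((hsub y hy).trans hrW)) fun z hz => hk z (hsub y hy hz)
  calc ‖fderiv ℂ (R k).1 y v‖ ≤ ‖fderiv ℂ (R k).1 y‖ * ‖v‖ := ContinuousLinearMap.le_opNorm _ _
    _ ≤ (2 * (ε * (r / 2) / 2 / (‖v‖ + 1)) / (r / 2)) * (‖v‖ + 1) := by gcongr; linarith
    _ = ε := by field_simp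

lemma dir_mem_nullPreserving (v : E) : dir W v ∈ nullPreserving W := fun _ hR => hR.dir v

end Hol

end HolomorphicSpace

namespace Hol

section Operators

variable {n : ℕ} {W W' : Opens (ℂ × (Fin n → ℂ))}

/-- Multiplication by the variable `t`. -/
noncomputable def tMul (W : Opens (ℂ × (Fin n → ℂ))) : Module.End ℂ (Hol W) := mul W Prod.fst

lemma tMul_val (F : Hol W) (q : ℂ × (Fin n → ℂ)) : (tMul W F).1 q = q.1 * F.1 q :=
  mul_val differentiable_fst.differentiableOn F q

/-- The shifted Euler operator `θ_t + c`. -/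
noncomputable def euler (W : Opens (ℂ × (Fin n → ℂ))) (c : ℂ) : Module.End ℂ (Hol W) :=
  tMul W * dir W (1, 0) + algebraMap ℂ _ c

lemma euler_apply (c : ℂ) (F : Hol W) : euler W c F = tMul W (dir W (1, 0) F) + c • F := rfl

lemma euler_val (c : ℂ) (F : Hol W) (q : ℂ × (Fin n → ℂ)) :
    (euler W c F).1 q = q.1 * (dir W (1, 0) F).1 q + c * F.1 q := by
  rw [euler_apply, add_val, tMul_val, smul_val]

/-- The partial derivative `∂_{x_k}` on `Hol W`. -/
noncomputable def dx (W : Opens (ℂ × (Fin n → ℂ))) (k : Fin n) : Module.End ℂ (Hol W) :=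
  dir W (0, Pi.single k 1)

/-- The iterated partial derivative `∂_x^α` on `Hol W`. -/
noncomputable def dxPow (W : Opens (ℂ × (Fin n → ℂ))) (α : Fin n → ℕ) : Module.End ℂ (Hol W) :=
  ((List.finRange n).map fun k => dx W k ^ α k).prod

lemma dir_tMul (v : ℂ × (Fin n → ℂ)) (F : Hol W) :
    dir W v (tMul W F) = v.1 • F + tMul W (dir W v F) := by
  refine ext_on fun q hq => ?_
  have h1 : (tMul W F).1 = Prod.fst * F.1 := funext (tMul_val F)
  have h2 := (hasFDerivAt_fst (𝕜 := ℂ) (p := q)).mul (diffAt F hq).hasFDerivAt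
  rw [dir_val v _ hq, h1, h2.fderiv, add_val, smul_val, tMul_val, dir_val v _ hq]
  simp
  ring

lemma semiconjBy_tMul_euler (c : ℂ) : SemiconjBy (tMul W) (euler W (c + 1)) (euler W c) := by
  refine LinearMap.ext fun F => ext_on fun q _ => ?_
  simp only [Module.End.mul_apply, euler_apply, dir_tMul, map_add, add_val, tMul_val, smul_val]
  ring

lemma commute_tMul_dx (k : Fin n) : Commute (tMul W) (dx W k) := by
  refine LinearMap.ext fun F => ?_
  simp [Module.End.mul_apply, dx, dir_tMul]

lemma commute_tMul_dxPow (α : Fin n → ℕ) : Commute (tMul W) (dxPow W α) := by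
  refine Commute.list_prod_right _ _ fun x hx => ?_
  obtain ⟨k, -, rfl⟩ := List.mem_map.1 hx
  exact (commute_tMul_dx k).pow_right _

lemma commute_tMul_mul {a : ℂ × (Fin n → ℂ) → ℂ} (ha : DifferentiableOn ℂ a W) :
    Commute (tMul W) (mul W a) := by
  refine LinearMap.ext fun F => ext_on fun q _ => ?_
  simp only [Module.End.mul_apply, tMul_val, mul_val ha]
  ring

lemma euler_pow_val_zero (c : ℂ) (j : ℕ) (F : Hol W) (x : Fin n → ℂ) :
    ((euler W c ^ j) F).1 (0, x) = c ^ j * F.1 (0, x) := by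
  induction j with
  | zero => simp
  | succ j ih =>
    rw [pow_succ', Module.End.mul_apply, euler_val, ih]
    simp [pow_succ']
    ring

lemma res_tMul (h : W' ≤ W) (F : Hol W) : res h (tMul W F) = tMul W' (res h F) :=
  res_mul h differentiable_fst.differentiableOn F

lemma res_euler (h : W' ≤ W) (c : ℂ) (F : Hol W) :
    res h (euler W c F) = euler W' c (res h F) := by
  simp only [euler_apply, map_add, map_smul, res_tMul, res_dir]

lemma res_pow (h : W' ≤ W) {S : Module.End ℂ (Hol W)} {S' : Module.End ℂ (Hol W')}
    (hS : ∀ F, res h (S F) = S' (res h F)) (j : ℕ) (F : Hol W) :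
    res h ((S ^ j) F) = (S' ^ j) (res h F) := by
  induction j with
  | zero => simp
  | succ j ih => rw [pow_succ', pow_succ', Module.End.mul_apply, Module.End.mul_apply, hS, ih]

lemma res_dxPow (h : W' ≤ W) (α : Fin n → ℕ) (F : Hol W) :
    res h (dxPow W α F) = dxPow W' α (res h F) := by
  unfold dxPow
  induction List.finRange n generalizing F with
  | nil => simp
  | cons k l ih =>
    simp only [List.map_cons, List.prod_cons, Module.End.mul_apply]
    rw [res_pow h (S := dx W k) (S' := dx W' k) (fun F => res_dir h _ F), ih]

lemma tMul_mem_nullPreserving : tMul W ∈ nullPreserving W := mul_mem_nullPreserving _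

lemma euler_mem_nullPreserving (c : ℂ) : euler W c ∈ nullPreserving W :=
  add_mem (mul_mem tMul_mem_nullPreserving (dir_mem_nullPreserving _))
    (Subalgebra.algebraMap_mem _ c)

lemma dxPow_mem_nullPreserving (α : Fin n → ℕ) : dxPow W α ∈ nullPreserving W := by
  refine list_prod_mem fun x hx => ?_
  obtain ⟨k, -, rfl⟩ := List.mem_map.1 hx
  exact pow_mem (dir_mem_nullPreserving _) _

end Operators

section Rays

variable {n : ℕ} {W : Opens (ℂ × (Fin n → ℂ))}

/-- `W` is star-shaped in the variable `t`. -/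
def RayStable (W : Opens (ℂ × (Fin n → ℂ))) : Prop :=
  ∀ q ∈ W, ∀ σ ∈ Icc (0 : ℝ) 1, ((σ : ℂ) * q.1, q.2) ∈ W

/-- The integral `∫₀¹ φ(σ) F(σt, x) dσ`. -/
noncomputable def ray (hW : RayStable W) {φ : ℝ → ℂ} (hφ : Continuous φ) (F : Hol W) : Hol W :=
  ofFun (fun q => ∫ σ in (0 : ℝ)..1, φ σ * F.1 ((σ : ℂ) * q.1, q.2)) <| by
    have := differentiableOn_integral_comp_affine (V := (W : Set (ℂ × (Fin n → ℂ)))) W.isOpen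
      (diffOn F) hφ
      (A := fun σ => (σ : ℂ) • ((ContinuousLinearMap.inl ℂ ℂ (Fin n → ℂ)).comp
          (ContinuousLinearMap.fst ℂ ℂ (Fin n → ℂ))) +
        (ContinuousLinearMap.inr ℂ ℂ (Fin n → ℂ)).comp (ContinuousLinearMap.snd ℂ ℂ (Fin n → ℂ)))
      (by fun_prop) (c := fun _ => 0) continuous_const (a := 0) (b := 1) zero_le_one
      (fun q hq σ hσ => by simpa using hW q hq σ hσ)
    simpa using this

lemma ray_val (hW : RayStable W) {φ : ℝ → ℂ} (hφ : Continuous φ) (F : Hol W)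
    {q : ℂ × (Fin n → ℂ)} (hq : q ∈ W) :
    (ray hW hφ F).1 q = ∫ σ in (0 : ℝ)..1, φ σ * F.1 ((σ : ℂ) * q.1, q.2) := by
  unfold ray
  exact ofFun_val _ hq

lemma hasDerivAt_ray (F : Hol W) {q : ℂ × (Fin n → ℂ)} {σ : ℝ} (h : ((σ : ℂ) * q.1, q.2) ∈ W) :
    HasDerivAt (fun σ : ℝ => F.1 ((σ : ℂ) * q.1, q.2))
      (q.1 * (dir W (1, 0) F).1 ((σ : ℂ) * q.1, q.2)) σ := by
  have h1 : HasDerivAt (fun s : ℂ => (s * q.1, q.2)) (q.1, 0) (σ : ℂ) := by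
    refine HasDerivAt.prodMk ?_ (hasDerivAt_const _ _)
    simpa using (hasDerivAt_id (σ : ℂ)).mul_const q.1
  have h2 := ((diffAt F h).hasFDerivAt.comp_hasDerivAt (σ : ℂ) h1).comp_ofReal
  have h3 : ((q.1, 0) : ℂ × (Fin n → ℂ)) = q.1 • (1, 0) := by simp
  rw [h3, map_smul, smul_eq_mul, ← dir_val _ _ h] at h2
  exact h2

lemma continuousOn_ray (hW : RayStable W) (F : Hol W) {q : ℂ × (Fin n → ℂ)} (hq : q ∈ W) :
    ContinuousOn (fun σ : ℝ => F.1 ((σ : ℂ) * q.1, q.2)) (Icc 0 1) := fun σ hσ =>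
  (hasDerivAt_ray F (hW q hq σ hσ)).continuousAt.continuousWithinAt

/-- A holomorphic function vanishing at `t = 0` is divisible by `t`. -/
lemma exists_eq_tMul (hW : RayStable W) (F : Hol W)
    (hF : ∀ x, (0, x) ∈ W → F.1 (0, x) = 0) : ∃ G : Hol W, F = tMul W G := by
  refine ⟨ray hW (φ := fun _ => 1) continuous_const (dir W (1, 0) F), ext_on fun q hq => ?_⟩
  have hIcc : uIcc (0 : ℝ) 1 = Icc 0 1 := uIcc_of_le zero_le_one
  have h := intervalIntegral.integral_eq_sub_of_hasDerivAt (a := 0) (b := 1)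
    (f := fun σ : ℝ => F.1 ((σ : ℂ) * q.1, q.2))
    (fun σ hσ => hasDerivAt_ray F (hW q hq σ (hIcc ▸ hσ)))
    (ContinuousOn.intervalIntegrable (by
      rw [hIcc]; exact continuousOn_const.mul (continuousOn_ray hW _ hq)))
  have h0 := hF q.2 (by simpa using hW q hq 0 (by simp))
  rw [tMul_val, ray_val _ _ _ hq]
  simp only [intervalIntegral.integral_const_mul, Complex.ofReal_one, one_mul, Complex.ofReal_zero,
    zero_mul, h0, sub_zero, Prod.mk.eta] at h ⊢
  exact h.symm

/-- The right inverse of `θ_t + μ + 1`. -/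
noncomputable def eulerInv (hW : RayStable W) {μ : ℂ} (hμ : 0 < μ.re) (F : Hol W) : Hol W :=
  ray hW (Complex.continuous_ofReal_cpow_const hμ) F

lemma euler_eulerInv (hW : RayStable W) {μ : ℂ} (hμ : 0 < μ.re) (F : Hol W) :
    euler W (μ + 1) (eulerInv hW hμ F) = F := by
  refine ext_on fun q hq => ?_
  set I := eulerInv hW hμ F with hI
  have hone : ((((1 : ℝ) : ℂ) * q.1, q.2) : ℂ × (Fin n → ℂ)) = q := by simp
  have hφ := Complex.continuous_ofReal_cpow_const hμ
  have hμ0 : μ ≠ 0 := fun h => by simp [h] at hμ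
  set U : Set ℝ := (fun σ : ℝ => (((σ : ℂ) * q.1, q.2) : ℂ × (Fin n → ℂ))) ⁻¹' W with hU
  have hUo : IsOpen U := W.isOpen.preimage (by fun_prop)
  have h1U : (1 : ℝ) ∈ U := by rw [hU, mem_preimage, hone]; exact hq
  set h : ℝ → ℂ := fun s => (s : ℂ) ^ μ * F.1 ((s : ℂ) * q.1, q.2) with hh
  have hcU : ContinuousOn h U := hφ.continuousOn.mul fun σ hσ =>
    (hasDerivAt_ray F hσ).continuousAt.continuousWithinAt
  have hint : IntervalIntegrable h volume 0 1 := by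
    refine ContinuousOn.intervalIntegrable ?_
    rw [uIcc_of_le zero_le_one]
    exact hφ.continuousOn.mul (continuousOn_ray hW F hq)
  have hftc : HasDerivAt (fun τ => ∫ s in (0 : ℝ)..τ, h s) (h 1) 1 :=
    intervalIntegral.integral_hasDerivAt_right hint
      (hcU.stronglyMeasurableAtFilter hUo 1 h1U) (hcU.continuousAt (hUo.mem_nhds h1U))
  have hpow : HasDerivAt (fun τ : ℝ => (τ : ℂ) ^ (μ + 1)) (μ + 1) 1 := by
    have := ((hasDerivAt_id ((1 : ℝ) : ℂ)).cpow_const (c := μ + 1) (by simp)).comp_ofReal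
    simpa using this
  have hprod := hpow.mul (hasDerivAt_ray I (q := q) (σ := 1) (by rw [hone]; exact hq))
  have heq : (fun τ => ∫ s in (0 : ℝ)..τ, h s) =ᶠ[𝓝 1]
      fun τ : ℝ => (τ : ℂ) ^ (μ + 1) * I.1 ((τ : ℂ) * q.1, q.2) := by
    filter_upwards [hUo.mem_nhds h1U, lt_mem_nhds (zero_lt_one (α := ℝ))] with τ hτ hτ0
    have hs' : (τ : ℂ) * ∫ σ in (0 : ℝ)..1, h (τ * σ) = ∫ s in (0 : ℝ)..τ, h s := by
      have := intervalIntegral.smul_integral_comp_mul_left (f := h) (a := 0) (b := 1) τ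
      rwa [mul_zero, mul_one, Complex.real_smul] at this
    rw [← hs', hI, eulerInv, ray_val _ _ _ hτ, Complex.cpow_add _ _ (by exact_mod_cast hτ0.ne'),
      Complex.cpow_one, mul_comm ((τ : ℂ) ^ μ), mul_assoc,
      ← intervalIntegral.integral_const_mul ((τ : ℂ) ^ μ)]
    congr 1
    refine intervalIntegral.integral_congr fun σ hσ => ?_
    rw [uIcc_of_le zero_le_one] at hσ
    simp only [hh, Complex.ofReal_mul]
    have hcomm : (τ : ℂ) * σ * q.1 = σ * (τ * q.1) := by ring
    rw [Complex.mul_cpow_ofReal_nonneg hτ0.le hσ.1, hcomm, mul_assoc]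
  have := hftc.unique (hprod.congr_of_eventuallyEq heq)
  simp only [hh, Complex.ofReal_one, Complex.one_cpow, one_mul, Prod.mk.eta] at this
  rw [euler_val, this]
  ring

end Rays

section Bounds

variable {n : ℕ} {W : Opens (ℂ × (Fin n → ℂ))} {K : Set ℂ} {k r : ℕ} {M : ℝ} {F G : Hol W}

/-- A bound by `M |t|^k / s^r` at points of distance at least `s` from the boundary. -/
def Bd (K : Set ℂ) (k r : ℕ) (M : ℝ) (F : Hol W) : Prop :=
  ∀ t ∈ K, ∀ (x : Fin n → ℂ) (s : ℝ), 0 < s → s ≤ 1 → K ×ˢ closedBall x s ⊆ (W : Set _) →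
    ‖F.1 (t, x)‖ ≤ M * ‖t‖ ^ k / s ^ r

lemma Bd.mono {M' : ℝ} (hF : Bd K k r M F) (h : M ≤ M') : Bd K k r M' F :=
  fun t ht x s hs hs1 hW => (hF t ht x s hs hs1 hW).trans (by gcongr)

lemma Bd.weaken {r' : ℕ} (hF : Bd K k r M F) (hM : 0 ≤ M) (h : r ≤ r') : Bd K k r' M F :=
  fun t ht x s hs hs1 hW => (hF t ht x s hs hs1 hW).trans
    (div_le_div_of_nonneg_left (by positivity) (by positivity) (pow_le_pow_of_le_one hs.le hs1 h))

lemma Bd.add {M' : ℝ} (hF : Bd K k r M F) (hG : Bd K k r M' G) : Bd K k r (M + M') (F + G) :=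
  fun t ht x s hs hs1 hW => by
    rw [add_val, add_mul, add_div]
    exact (norm_add_le _ _).trans (add_le_add (hF t ht x s hs hs1 hW) (hG t ht x s hs hs1 hW))

lemma Bd.zero : Bd K k r 0 (0 : Hol W) := fun t _ x s _ _ _ => by simp

lemma Bd.sum {ι : Type*} (S : Finset ι) {H : ι → Hol W} (hH : ∀ i ∈ S, Bd K k r M (H i)) :
    Bd K k r (S.card * M) (∑ i ∈ S, H i) := by
  classical
  induction S using Finset.induction_on with
  | empty => simpa using Bd.zero
  | insert i S hi ih =>
    rw [Finset.sum_insert hi, Finset.card_insert_of_notMem hi]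
    exact ((hH i (by simp)).add (ih fun j hj => hH j (by simp [hj]))).mono
      (le_of_eq (by push_cast; ring))

lemma Bd.smul (hF : Bd K k r M F) (c : ℂ) : Bd K k r (‖c‖ * M) (c • F) :=
  fun t ht x s hs hs1 hW => by
    rw [smul_val, norm_mul, mul_assoc, mul_div_assoc]
    exact mul_le_mul_of_nonneg_left (hF t ht x s hs hs1 hW) (norm_nonneg c)

lemma Bd.neg (hF : Bd K k r M F) : Bd K k r M (-F) :=
  fun t ht x s hs hs1 hW => by
    rw [neg_val, norm_neg]
    exact hF t ht x s hs hs1 hW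

lemma Bd.tMul (hF : Bd K k r M F) : Bd K (k + 1) r M (tMul W F) :=
  fun t ht x s hs hs1 hW => by
    rw [tMul_val, norm_mul, pow_succ', mul_left_comm, mul_div_assoc]
    exact mul_le_mul_of_nonneg_left (hF t ht x s hs hs1 hW) (norm_nonneg t)

lemma Bd.mul {a : ℂ × (Fin n → ℂ) → ℂ} (ha : DifferentiableOn ℂ a W) {A : ℝ}
    (hA : ∀ q ∈ W, ‖a q‖ ≤ A) (hF : Bd K k r M F) : Bd K k r (A * M) (mul W a F) :=
  fun t ht x s hs hs1 hW => by
    have hq : (t, x) ∈ W := hW ⟨ht, mem_closedBall_self hs.le⟩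
    rw [mul_val ha, norm_mul, mul_assoc, mul_div_assoc]
    exact mul_le_mul (hA _ hq) (hF t ht x s hs hs1 hW) (norm_nonneg _)
      ((norm_nonneg _).trans (hA _ hq))

lemma Bd.eulerInv (hW : RayStable W) (hK : ∀ t ∈ K, ∀ σ ∈ Icc (0 : ℝ) 1, (σ : ℂ) * t ∈ K)
    {μ : ℂ} (hμ : 0 < μ.re) (hF : Bd K k r M F) :
    Bd K k r (M / (k + 1)) (eulerInv hW hμ F) := by
  intro t ht x s hs hs1 hKW
  have hq : (t, x) ∈ W := hKW ⟨ht, mem_closedBall_self hs.le⟩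
  rw [Hol.eulerInv, ray_val _ _ _ hq]
  have hint : ∫ σ in (0 : ℝ)..1, M * ‖t‖ ^ k / s ^ r * σ ^ k =
      M / (k + 1) * ‖t‖ ^ k / s ^ r := by
    rw [intervalIntegral.integral_const_mul, integral_pow]
    simp
    ring
  rw [← hint]
  refine intervalIntegral.norm_integral_le_of_norm_le zero_le_one ?_
    (Continuous.intervalIntegrable (by fun_prop) _ _)
  refine Eventually.of_forall fun σ hσ => ?_
  have h1 : ‖(σ : ℂ) ^ μ‖ ≤ 1 := by
    rw [Complex.norm_cpow_eq_rpow_re_of_pos hσ.1]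
    exact Real.rpow_le_one hσ.1.le hσ.2 hμ.le
  have h2 := hF _ (hK t ht σ ⟨hσ.1.le, hσ.2⟩) x s hs hs1 hKW
  rw [norm_mul]
  calc _ ≤ 1 * (M * ‖(σ : ℂ) * t‖ ^ k / s ^ r) := mul_le_mul h1 h2 (norm_nonneg _) zero_le_one
    _ = _ := by
      rw [norm_mul, Complex.norm_real, Real.norm_of_nonneg hσ.1.le]
      ring

lemma Bd.dx (hF : Bd K k r M F) (hM : 0 ≤ M) (i : Fin n) :
    Bd K k (r + 1) (3 * (r + 2) * M) (dx W i F) := by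
  intro t ht x s hs hs1 hKW
  have hq : (t, x) ∈ W := hKW ⟨ht, mem_closedBall_self hs.le⟩
  set R : ℝ := s / (r + 2) with hR
  have hr2 : (0 : ℝ) < r + 2 := by positivity
  have hRpos : 0 < R := by positivity
  have hsR : 0 < s - R := by
    have : s - R = s * (r + 1) / (r + 2) := by rw [hR]; field_simp; ring
    rw [this]; positivity
  have hnorm : ∀ z : ℂ, ‖z • (Pi.single i 1 : Fin n → ℂ)‖ = ‖z‖ := fun z => by
    rw [norm_smul, Pi.norm_single]; simp
  have hball : ∀ z : ℂ, ‖z‖ ≤ R →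
      closedBall (x + z • (Pi.single i 1 : Fin n → ℂ)) (s - R) ⊆ closedBall x s := fun z hz =>
    closedBall_subset_closedBall' (by
      rw [dist_eq_norm, add_sub_cancel_left, hnorm]; linarith)
  have hmem : ∀ z : ℂ, ‖z‖ ≤ R →
      (t, x) + z • ((0, Pi.single i 1) : ℂ × (Fin n → ℂ)) ∈ W := fun z hz => by
    have : (t, x) + z • ((0, Pi.single i 1) : ℂ × (Fin n → ℂ)) =
      (t, x + z • (Pi.single i 1 : Fin n → ℂ)) := by simp
    rw [this]
    exact hKW ⟨ht, hball z hz (mem_closedBall_self hsR.le)⟩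
  rw [Hol.dx, dir_val_eq_deriv _ _ hq]
  have hbound : ‖deriv (fun z : ℂ => F.1 ((t, x) + z • ((0, Pi.single i 1) : ℂ × (Fin n → ℂ)))) 0‖
      ≤ (M * ‖t‖ ^ k / (s - R) ^ r) / R := by
    refine Complex.norm_deriv_le_of_forall_mem_sphere_norm_le hRpos ?_ fun z hz => ?_
    · refine DifferentiableOn.diffContOnCl fun z hz => ?_
      rw [closure_ball _ hRpos.ne', mem_closedBall_zero_iff] at hz
      exact (hasDerivAt_comp_line
        (diffAt F (hmem z hz))).differentiableAt.differentiableWithinAt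
    · have hz' : ‖z‖ ≤ R := by rw [mem_sphere_zero_iff_norm] at hz; exact hz.le
      have : (t, x) + z • ((0, Pi.single i 1) : ℂ × (Fin n → ℂ)) =
        (t, x + z • (Pi.single i 1 : Fin n → ℂ)) := by simp
      rw [this]
      exact hF t ht _ _ hsR (by linarith) ((prod_mono_right (hball z hz')).trans hKW)
  refine hbound.trans ?_
  have hratio : s = (s - R) * (1 + 1 / (r + 1)) := by rw [hR]; field_simp; ring
  have hexp : (1 + 1 / ((r : ℝ) + 1)) ^ r ≤ 3 := by
    have h1 : (1 : ℝ) + 1 / (r + 1) ≤ Real.exp (1 / (r + 1)) := by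
      rw [add_comm]; exact Real.add_one_le_exp _
    calc (1 + 1 / ((r : ℝ) + 1)) ^ r ≤ Real.exp (1 / (r + 1)) ^ r := by gcongr
      _ = Real.exp (r * (1 / (r + 1))) := (Real.exp_nat_mul _ _).symm
      _ ≤ Real.exp 1 := by
        apply Real.exp_le_exp.2
        rw [mul_one_div, div_le_one (by positivity)]
        linarith
      _ ≤ 3 := by linarith [Real.exp_one_lt_d9]
  have hpow : s ^ r ≤ 3 * (s - R) ^ r := by
    calc s ^ r = (s - R) ^ r * (1 + 1 / ((r : ℝ) + 1)) ^ r := by rw [← mul_pow, ← hratio]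
      _ ≤ (s - R) ^ r * 3 := by gcongr
      _ = _ := mul_comm _ _
  have hinv : 1 / (s - R) ^ r ≤ 3 / s ^ r := by
    rw [div_le_div_iff₀ (by positivity) (by positivity)]; linarith
  calc M * ‖t‖ ^ k / (s - R) ^ r / R = M * ‖t‖ ^ k / R * (1 / (s - R) ^ r) := by ring
    _ ≤ M * ‖t‖ ^ k / R * (3 / s ^ r) := by gcongr
    _ = _ := by rw [hR, pow_succ]; field_simp

lemma Bd.dx_pow {B : ℕ} (hF : Bd K k r M F) (hM : 0 ≤ M) (i : Fin n) (j : ℕ) (hB : r + j ≤ B) :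
    Bd K k (r + j) ((3 * (B + 2)) ^ j * M) ((Hol.dx W i ^ j) F) := by
  induction j with
  | zero => simpa using hF
  | succ j ih =>
    rw [pow_succ' (Hol.dx W i), Module.End.mul_apply]
    refine ((ih (by omega)).dx (by positivity) i).mono ?_
    rw [pow_succ', mul_assoc (3 * ((B : ℝ) + 2))]
    have : ((r + j : ℕ) : ℝ) ≤ B := by exact_mod_cast (by omega : r + j ≤ B)
    gcongr

lemma Bd.dxPow {B : ℕ} (hF : Bd K k r M F) (hM : 0 ≤ M) (α : Fin n → ℕ)
    (hB : r + ∑ i, α i ≤ B) :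
    Bd K k (r + ∑ i, α i) ((3 * (B + 2)) ^ (∑ i, α i) * M) (dxPow W α F) := by
  have hsum : ∑ i, α i = ((List.finRange n).map α).sum := by
    rw [← List.sum_ofFn, List.ofFn_eq_map]
  rw [hsum] at hB ⊢
  unfold Hol.dxPow
  generalize List.finRange n = l at hB
  induction l with
  | nil => simpa using hF
  | cons i l ih =>
    simp only [List.map_cons, List.prod_cons, List.sum_cons, Module.End.mul_apply] at hB ⊢
    refine cast ?_ (((ih (by omega)).dx_pow (B := B) (by positivity) i (α i) (by omega)))
    rw [pow_add, mul_assoc, add_assoc, add_comm (α i)]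

/-- A right inverse, with bounds, of a polynomial in the Euler operator. -/
lemma exists_rightInverse (hW : RayStable W) (c : ℂ) (Λ : ℝ) (L : List ℂ)
    (hL : ∀ z ∈ L, 0 < (c - z - 1).re ∧ ‖z‖ ≤ Λ) :
    ∃ T : Hol W → Hol W,
      (∀ F, aeval (euler W c) (L.map fun z => X - C z).prod (T F) = F) ∧
      ∀ K : Set ℂ, (∀ t ∈ K, ∀ σ ∈ Icc (0 : ℝ) 1, (σ : ℂ) * t ∈ K) →
        ∀ (k r : ℕ) (M : ℝ) (F : Hol W), 0 ≤ M → Bd K k r M F → ∀ j ≤ L.length,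
          Bd K k r ((1 + Λ) ^ j * M / (k + 1) ^ (L.length - j)) ((euler W c ^ j) (T F)) := by
  induction L with
  | nil =>
    refine ⟨id, fun F => by simp, fun K _ k r M F _ hF j hj => ?_⟩
    obtain rfl : j = 0 := by simpa using hj
    simpa using hF
  | cons z L ih =>
    obtain ⟨T, hT, hTB⟩ := ih fun z hz => hL z (by simp [hz])
    obtain ⟨hz, hzΛ⟩ := hL z (by simp)
    have hinv : ∀ F, euler W c (eulerInv hW hz F) = F + z • eulerInv hW hz F := fun F => by
      have h := euler_eulerInv hW hz F
      rw [euler_apply] at h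
      rw [euler_apply, ← sub_eq_zero]
      rw [← sub_eq_zero] at h
      rw [← h, ← sub_eq_zero]
      module
    refine ⟨fun F => eulerInv hW hz (T F), fun F => ?_, fun K hK k r M F hM hF j hj => ?_⟩
    · rw [List.map_cons, List.prod_cons, mul_comm, map_mul, Module.End.mul_apply]
      have : aeval (euler W c) (X - C z) (eulerInv hW hz (T F)) = T F := by
        rw [map_sub, aeval_X, aeval_C, LinearMap.sub_apply, hinv, Module.algebraMap_end_apply,
          add_sub_cancel_right]
      rw [this, hT]
    · have hΛ : 0 ≤ Λ := (norm_nonneg z).trans hzΛ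
      induction j with
      | zero =>
        have := (hTB K hK k r M F hM hF 0 (Nat.zero_le _)).eulerInv hW hK hz
        refine this.mono (le_of_eq ?_)
        simp only [pow_zero, one_mul, Nat.sub_zero, List.length_cons, pow_succ]
        rw [div_div]
      | succ j ihj =>
        rw [List.length_cons] at hj
        have h1 := hTB K hK k r M F hM hF j (by omega)
        have h2 := (ihj (by simp; omega)).smul z
        have h3 : (euler W c ^ (j + 1)) (eulerInv hW hz (T F)) =
            (euler W c ^ j) (T F) + z • (euler W c ^ j) (eulerInv hW hz (T F)) := by
          rw [pow_succ, Module.End.mul_apply, hinv, map_add, map_smul]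
        rw [h3]
        refine (h1.add h2).mono ?_
        have e1 : (z :: L).length - j = L.length - j + 1 := by simp; omega
        have e2 : (z :: L).length - (j + 1) = L.length - j := by simp
        rw [e1, e2]
        set Y : ℝ := (1 + Λ) ^ j * M / (k + 1) ^ (L.length - j) with hY
        have hY0 : 0 ≤ Y := by positivity
        have h4 : (1 + Λ) ^ j * M / ((k : ℝ) + 1) ^ (L.length - j + 1) ≤ Y := by
          refine div_le_div_of_nonneg_left (by positivity) (by positivity) ?_
          exact pow_le_pow_right₀ (by linarith [(Nat.cast_nonneg k : (0 : ℝ) ≤ k)]) (by omega)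
        calc Y + ‖z‖ * _ ≤ Y + Λ * Y := by gcongr
          _ = _ := by rw [hY, pow_succ]; ring

lemma Bd.term (c : ℂ) {Λ A : ℝ} (hΛ : 0 ≤ Λ) (hA0 : 0 ≤ A) {m j : ℕ} {T : Hol W → Hol W}
    (hT : ∀ (F : Hol W) (M : ℝ), 0 ≤ M → Bd K k (m * k) M F → ∀ j ≤ m,
      Bd K k (m * k) ((1 + Λ) ^ j * M / (k + 1) ^ (m - j)) ((euler W c ^ j) (T F)))
    {a : ℂ × (Fin n → ℂ) → ℂ} (ha : DifferentiableOn ℂ a W) (hA : ∀ q ∈ W, ‖a q‖ ≤ A)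
    (α : Fin n → ℕ) (hα : ∑ i, α i + j ≤ m) (hM : 0 ≤ M) (hF : Bd K k (m * k) M F) :
    Bd K k (m * (k + 1)) (A * ((3 * (m + 2)) ^ m * (1 + Λ) ^ m) * M)
      (Hol.mul W a (Hol.dxPow W α ((euler W c ^ j) (T F)))) := by
  have h1 := hT F M hM hF j (by omega)
  have hk : (0 : ℝ) < k + 1 := by positivity
  have h2 := (h1.dxPow (B := m * (k + 1)) (by positivity) α (by rw [mul_add]; omega)).weaken
    (r' := m * (k + 1)) (by positivity) (by rw [mul_add]; omega)
  refine (h2.mul ha hA).mono ?_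
  rw [mul_assoc A]
  refine mul_le_mul_of_nonneg_left ?_ hA0
  set b := ∑ i, α i
  have hb : b ≤ m - j := by omega
  have hk1 : (1 : ℝ) ≤ k + 1 := by linarith [(Nat.cast_nonneg k : (0 : ℝ) ≤ k)]
  calc (3 * (((m * (k + 1) : ℕ) : ℝ) + 2)) ^ b * ((1 + Λ) ^ j * M / ((k : ℝ) + 1) ^ (m - j))
      ≤ (3 * (m + 2) * (k + 1)) ^ b * ((1 + Λ) ^ m * M / ((k : ℝ) + 1) ^ (m - j)) := by
        gcongr ?_ ^ b * (?_ * M / _)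
        · push_cast; nlinarith
        · exact pow_le_pow_right₀ (by linarith) (by omega)
    _ = (3 * (m + 2)) ^ b * (1 + Λ) ^ m * M * ((k + 1) ^ b / ((k : ℝ) + 1) ^ (m - j)) := by
        rw [mul_pow _ ((k : ℝ) + 1)]; ring
    _ ≤ (3 * (m + 2)) ^ m * (1 + Λ) ^ m * M * 1 := by
        gcongr ?_ ^ ?_ * _ * M * ?_
        · linarith [(Nat.cast_nonneg m : (0 : ℝ) ≤ m)]
        · omega
        · rw [div_le_one (by positivity)]
          exact pow_le_pow_right₀ hk1 hb
    _ = _ := mul_one _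

end Bounds

section System

variable {n N : ℕ} {W W' : Opens (ℂ × (Fin n → ℂ))}

/-- The pairs `(j, α)` with `|α| + j ≤ m`. -/
def idx (n m : ℕ) : Finset (ℕ × (Fin n → ℕ)) :=
  (Finset.range (m + 1) ×ˢ Fintype.piFinset fun _ : Fin n => Finset.range (m + 1)).filter
    fun s => ∑ k, s.2 k + s.1 ≤ m

lemma le_of_mem_idx {m : ℕ} {s : ℕ × (Fin n → ℕ)} (hs : s ∈ idx n m) : ∑ k, s.2 k + s.1 ≤ m :=
  (Finset.mem_filter.1 hs).2

variable (a : Fin N → Fin N → ℕ × (Fin n → ℕ) → ℂ × (Fin n → ℂ) → ℂ) (m : ℕ) (p : ℂ[X])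

/-- The `(i, l)` entry of the perturbation, with `θ_t` replaced by `θ_t + c`. -/
noncomputable def entry (W : Opens (ℂ × (Fin n → ℂ))) (c : ℂ) (i l : Fin N) :
    Module.End ℂ (Hol W) :=
  ∑ s ∈ idx n m, mul W (a i l s) * dxPow W s.2 * euler W c ^ s.1

/-- The Fuchsian system acting on holomorphic functions, with `θ_t` replaced by `θ_t + c`. -/
noncomputable def sysOp (W : Opens (ℂ × (Fin n → ℂ))) (c : ℂ) :
    Module.End ℂ (Fin N → Hol W) :=
  LinearMap.pi fun i => aeval (euler W c) p ∘ₗ LinearMap.proj i +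
    ∑ l, (tMul W * entry a m W c i l) ∘ₗ LinearMap.proj l

variable {a m p}

lemma entry_apply (c : ℂ) (i l : Fin N) (F : Hol W) : entry a m W c i l F =
    ∑ s ∈ idx n m, mul W (a i l s) (dxPow W s.2 ((euler W c ^ s.1) F)) := by
  simp [entry, LinearMap.sum_apply, Module.End.mul_apply]

lemma sysOp_apply (c : ℂ) (U : Fin N → Hol W) (i : Fin N) : sysOp a m p W c U i =
    aeval (euler W c) p (U i) + ∑ l, tMul W (entry a m W c i l (U l)) := by
  simp [sysOp, LinearMap.sum_apply, Module.End.mul_apply]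

lemma aeval_euler_apply (c : ℂ) (F : Hol W) : aeval (euler W c) p F =
    ∑ j ∈ Finset.range (p.natDegree + 1), p.coeff j • (euler W c ^ j) F := by
  rw [aeval_eq_sum_range, LinearMap.sum_apply]; rfl

lemma res_aeval_euler (h : W' ≤ W) (c : ℂ) (F : Hol W) :
    res h (aeval (euler W c) p F) = aeval (euler W' c) p (res h F) := by
  simp only [aeval_euler_apply, map_sum, map_smul, res_pow h (res_euler h c)]

lemma res_sysOp (h : W' ≤ W) (ha : ∀ i l, ∀ s ∈ idx n m, DifferentiableOn ℂ (a i l s) W) (c : ℂ)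
    (U : Fin N → Hol W) (i : Fin N) :
    res h (sysOp a m p W c U i) = sysOp a m p W' c (fun l => res h (U l)) i := by
  simp only [sysOp_apply, entry_apply, map_add, map_sum, res_aeval_euler, res_tMul]
  congr 1
  refine Finset.sum_congr rfl fun l _ => Finset.sum_congr rfl fun s hs => ?_
  rw [res_mul h (ha i l s hs), res_dxPow, res_pow h (res_euler h c)]

lemma euler_pow_tMul (c : ℂ) (j : ℕ) (F : Hol W) :
    (euler W c ^ j) (tMul W F) = tMul W ((euler W (c + 1) ^ j) F) :=
  (LinearMap.congr_fun ((semiconjBy_tMul_euler c).pow_right j) F).symm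

lemma sysOp_tMul (ha : ∀ i l, ∀ s ∈ idx n m, DifferentiableOn ℂ (a i l s) W) (c : ℂ)
    (U : Fin N → Hol W) (i : Fin N) :
    sysOp a m p W c (fun l => tMul W (U l)) i = tMul W (sysOp a m p W (c + 1) U i) := by
  simp only [sysOp_apply, entry_apply, aeval_euler_apply, map_add, map_sum, map_smul,
    euler_pow_tMul]
  congr 1
  refine Finset.sum_congr rfl fun l _ => Finset.sum_congr rfl fun s hs => ?_
  have h1 := fun F : Hol W => LinearMap.congr_fun (commute_tMul_dxPow (W := W) s.2).eq F
  have h2 := fun F : Hol W => LinearMap.congr_fun (commute_tMul_mul (ha i l s hs)).eq F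
  simp only [Module.End.mul_apply] at h1 h2
  rw [← h1, ← h2]

lemma sysOp_val_zero (c : ℂ) (U : Fin N → Hol W) (i : Fin N) (x : Fin n → ℂ) :
    (sysOp a m p W c U i).1 (0, x) = p.eval c * (U i).1 (0, x) := by
  simp only [sysOp_apply, aeval_euler_apply, add_val, sum_val, tMul_val, smul_val,
    euler_pow_val_zero, zero_mul, Finset.sum_const_zero, add_zero]
  rw [eval_eq_sum_range, Finset.sum_mul]
  simp only [mul_assoc]

lemma aeval_mem_nullPreserving (c : ℂ) : aeval (euler W c) p ∈ nullPreserving W := by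
  rw [aeval_eq_sum_range]
  exact sum_mem fun j _ => Subalgebra.smul_mem _ (pow_mem (euler_mem_nullPreserving c) j) _

lemma entry_mem_nullPreserving (c : ℂ) (i l : Fin N) :
    entry a m W c i l ∈ nullPreserving W :=
  sum_mem fun _ _ => mul_mem (mul_mem (mul_mem_nullPreserving _) (dxPow_mem_nullPreserving _))
    (pow_mem (euler_mem_nullPreserving c) _)

lemma IsNull.zero : IsNull fun _ : ℕ => (0 : Hol W) := fun q hq => by
  obtain ⟨r, hr, hrW⟩ := Metric.isOpen_iff.1 W.isOpen q hq
  exact ⟨r, hr, hrW, fun ε hε => Eventually.of_forall fun k y _ => by simp [hε.le]⟩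

lemma IsNull.sum {ι : Type*} (S : Finset ι) {R : ι → ℕ → Hol W} (hR : ∀ l ∈ S, IsNull (R l)) :
    IsNull fun k => ∑ l ∈ S, R l k := by
  classical
  induction S using Finset.induction_on with
  | empty => simpa using IsNull.zero
  | insert i S hi ih =>
    simp only [Finset.sum_insert hi]
    exact (hR i (by simp)).add (ih fun j hj => hR j (by simp [hj]))

lemma IsNull.sysOp (c : ℂ) {R : ℕ → Fin N → Hol W} (hR : ∀ l, IsNull fun k => R k l) (i : Fin N) :
    IsNull fun k => Hol.sysOp a m p W c (R k) i := by
  simp only [sysOp_apply]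
  exact (aeval_mem_nullPreserving c _ (hR i)).add (IsNull.sum _ fun l _ =>
    tMul_mem_nullPreserving _ (entry_mem_nullPreserving c i l _ (hR l)))

lemma isNull_of_geometric {w : ℕ → Hol W}
    (hw : ∀ q ∈ W, ∃ r > 0, ball q r ⊆ W ∧ ∃ M : ℝ, ∀ k, ∀ y ∈ ball q r,
      ‖(w k).1 y‖ ≤ M * (1 / 2) ^ k) : IsNull w := by
  intro q hq
  obtain ⟨r, hr, hrW, M, hM⟩ := hw q hq
  refine ⟨r, hr, hrW, fun ε hε => ?_⟩
  have hlim : Tendsto (fun k : ℕ => M * (1 / 2 : ℝ) ^ k) atTop (𝓝 0) := by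
    simpa using (tendsto_pow_atTop_nhds_zero_of_lt_one (r := (1 / 2 : ℝ)) (by norm_num)
      (by norm_num)).const_mul M
  filter_upwards [hlim.eventually (gt_mem_nhds hε)] with k hk y hy
  exact (hM k y hy).trans hk.le

/-- Solvability by successive approximation when all characteristic exponents are far to the
left. -/
lemma exists_sysOp_eq_res (h : W' ≤ W) (hW : RayStable W) (c : ℂ) {Λ A δ : ℝ} (hΛ : 0 ≤ Λ)
    (hA0 : 0 ≤ A) (hδ : 0 < δ) (hδ1 : δ ≤ 1) (L : List ℂ)
    (hp : p = (L.map fun z => X - C z).prod) (hLm : L.length = m)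
    (hL : ∀ z ∈ L, 0 < (c - z - 1).re ∧ ‖z‖ ≤ Λ)
    (ha : ∀ i l, ∀ s ∈ idx n m, DifferentiableOn ℂ (a i l s) W)
    (hA : ∀ i l, ∀ s ∈ idx n m, ∀ q ∈ W, ‖a i l s q‖ ≤ A) (f : Fin N → Hol W)
    (hf : ∀ q ∈ W', ∃ r > 0, ball q r ⊆ W' ∧ ∃ K : Set ℂ, ∃ M ≥ 0,
      (∀ t ∈ K, ∀ σ ∈ Icc (0 : ℝ) 1, (σ : ℂ) * t ∈ K) ∧
      (∀ t ∈ K, N * ((idx n m).card * (A * ((3 * (m + 2)) ^ m * (1 + Λ) ^ m))) * ‖t‖ ≤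
        1 / 2 * δ ^ m) ∧
      (∀ y ∈ ball q r, y.1 ∈ K ∧ K ×ˢ closedBall y.2 δ ⊆ (W : Set _)) ∧
      ∀ i, Bd K 0 0 M (f i)) :
    ∃ u : Fin N → Hol W', ∀ i, sysOp a m p W' c u i = res h (f i) := by
  obtain ⟨T, hT, hTB⟩ := exists_rightInverse hW c Λ L hL
  rw [← hp] at hT
  rw [hLm] at hTB
  set C₀ : ℝ := N * ((idx n m).card * (A * ((3 * (m + 2)) ^ m * (1 + Λ) ^ m))) with hC₀
  have hC : 0 ≤ C₀ := by positivity
  set g : ℕ → Fin N → Hol W := fun k => Nat.rec f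
    (fun _ gk i => -∑ l, tMul W (entry a m W c i l (T (gk l)))) k with hg
  have hg0 : g 0 = f := rfl
  have hgs : ∀ k i, g (k + 1) i = -∑ l, tMul W (entry a m W c i l (T (g k l))) := fun k i => rfl
  have hsys : ∀ k i, sysOp a m p W c (fun l => T (g k l)) i = g k i - g (k + 1) i := fun k i => by
    rw [sysOp_apply, hgs, hT, sub_neg_eq_add]
  have hgB : ∀ (K : Set ℂ) (M : ℝ), 0 ≤ M →
      (∀ t ∈ K, ∀ σ ∈ Icc (0 : ℝ) 1, (σ : ℂ) * t ∈ K) → (∀ i, Bd K 0 0 M (f i)) →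
      ∀ k i, Bd K k (m * k) (C₀ ^ k * M) (g k i) := by
    intro K M hM hK hfK k
    induction k with
    | zero => intro i; simpa [hg0] using hfK i
    | succ k ih =>
      intro i
      rw [hgs]
      have hterm : ∀ l ∈ Finset.univ, Bd K (k + 1) (m * (k + 1))
          ((idx n m).card * (A * ((3 * (m + 2)) ^ m * (1 + Λ) ^ m) * (C₀ ^ k * M)))
          (tMul W (entry a m W c i l (T (g k l)))) := fun l _ => by
        refine Bd.tMul ?_
        rw [entry_apply]
        exact Bd.sum _ fun s hs => Bd.term c hΛ hA0 (fun F M hM hF => hTB K hK k _ M F hM hF)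
          (ha i l s hs) (hA i l s hs) s.2 (le_of_mem_idx hs) (by positivity) (ih l)
      refine (Bd.sum _ hterm).neg.mono (le_of_eq ?_)
      rw [Finset.card_univ, Fintype.card_fin, pow_succ, hC₀]
      ring
  have hwB : ∀ (K : Set ℂ) (M : ℝ), 0 ≤ M →
      (∀ t ∈ K, ∀ σ ∈ Icc (0 : ℝ) 1, (σ : ℂ) * t ∈ K) → (∀ i, Bd K 0 0 M (f i)) →
      ∀ k i, Bd K k (m * k) (C₀ ^ k * M) (T (g k i)) := by
    intro K M hM hK hfK k i
    have := hTB K hK k _ _ _ (by positivity) (hgB K M hM hK hfK k i) 0 (Nat.zero_le _)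
    simp only [pow_zero, one_mul, Nat.sub_zero, Module.End.one_apply] at this
    refine this.mono (div_le_self (by positivity) (one_le_pow₀ ?_))
    linarith [(Nat.cast_nonneg k : (0 : ℝ) ≤ k)]
  have hgeom : ∀ H : ℕ → Hol W, (∀ (K : Set ℂ) (M : ℝ), 0 ≤ M →
      (∀ t ∈ K, ∀ σ ∈ Icc (0 : ℝ) 1, (σ : ℂ) * t ∈ K) → (∀ i, Bd K 0 0 M (f i)) →
      ∀ k, Bd K k (m * k) (C₀ ^ k * M) (H k)) →
      ∀ q ∈ W', ∃ r > 0, ball q r ⊆ W' ∧ ∃ M : ℝ, ∀ k, ∀ y ∈ ball q r,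
        ‖(res h (H k)).1 y‖ ≤ M * (1 / 2) ^ k := by
    intro H hH q hq
    obtain ⟨r, hr, hrW, K, M, hM, hK, hKs, hy, hfK⟩ := hf q hq
    refine ⟨r, hr, hrW, M, fun k y hyr => ?_⟩
    rw [res_val h _ (hrW hyr)]
    refine (hH K M hM hK hfK k y.1 (hy y hyr).1 y.2 δ hδ hδ1 (hy y hyr).2).trans ?_
    have h1 : C₀ * ‖y.1‖ / δ ^ m ≤ 1 / 2 := by
      rw [div_le_iff₀ (by positivity)]
      exact hKs _ (hy y hyr).1
    calc C₀ ^ k * M * ‖y.1‖ ^ k / δ ^ (m * k) = M * (C₀ * ‖y.1‖ / δ ^ m) ^ k := by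
          rw [pow_mul, div_pow, mul_pow]; ring
      _ ≤ M * (1 / 2) ^ k := by gcongr
  have hsum := fun i => exists_sum (fun k => res h (T (g k i)))
    (hgeom (fun k => T (g k i)) fun K M hM hK hfK k => hwB K M hM hK hfK k i)
  choose u hu using hsum
  have hgn := fun i => isNull_of_geometric
    (hgeom (fun k => g k i) fun K M hM hK hfK k => hgB K M hM hK hfK k i)
  refine ⟨u, fun i => ?_⟩
  have htel : ∀ k, sysOp a m p W' c (fun l => ∑ k ∈ Finset.range k, res h (T (g k l))) i =
      res h (f i) - res h (g k i) := by
    intro k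
    have e1 : (fun l => ∑ k ∈ Finset.range k, res h (T (g k l))) =
        ∑ k ∈ Finset.range k, fun l => res h (T (g k l)) := by
      funext l; rw [Finset.sum_apply]
    rw [e1, map_sum, Finset.sum_apply]
    simp only [← res_sysOp h ha, hsys, map_sub]
    rw [Finset.sum_range_sub', hg0]
  have hnull := (IsNull.sysOp (a := a) (m := m) (p := p) c
    (R := fun k l => u l - ∑ k ∈ Finset.range k, res h (T (g k l))) hu i)
  refine ext_on fun q hq => ?_
  have hlim := (hnull.tendsto hq).sub ((hgn i).tendsto hq)
  have hconst : ∀ k, (sysOp a m p W' c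
      (fun l => u l - ∑ k ∈ Finset.range k, res h (T (g k l))) i).1 q - (res h (g k i)).1 q =
      (sysOp a m p W' c u i).1 q - (res h (f i)).1 q := by
    intro k
    have e2 : (fun l => u l - ∑ k ∈ Finset.range k, res h (T (g k l))) =
      u - fun l => ∑ k ∈ Finset.range k, res h (T (g k l)) := rfl
    rw [e2, map_sub, Pi.sub_apply, htel]
    simp only [sub_val]
    ring
  simp only [hconst, sub_zero] at hlim
  exact sub_eq_zero.1 (tendsto_nhds_unique tendsto_const_nhds hlim)

end System

section Shift

variable {n N : ℕ} {W W' : Opens (ℂ × (Fin n → ℂ))}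
  {a : Fin N → Fin N → ℕ × (Fin n → ℕ) → ℂ × (Fin n → ℂ) → ℂ} {m : ℕ} {p : ℂ[X]}

lemma exists_sysOp_eq_res_of_succ (h : W' ≤ W) (hW : RayStable W)
    (ha : ∀ i l, ∀ s ∈ idx n m, DifferentiableOn ℂ (a i l s) W) (c : ℂ) (hc : p.eval c ≠ 0)
    (hsucc : ∀ f : Fin N → Hol W, ∃ u : Fin N → Hol W',
      ∀ i, sysOp a m p W' (c + 1) u i = res h (f i)) (f : Fin N → Hol W) :
    ∃ u : Fin N → Hol W', ∀ i, sysOp a m p W' c u i = res h (f i) := by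
  set u₀ : Fin N → Hol W := fun i => (p.eval c)⁻¹ • f i with hu₀
  have hdiv : ∀ i, ∃ g, f i - sysOp a m p W c u₀ i = tMul W g := fun i =>
    exists_eq_tMul hW _ fun x _ => by
      rw [sub_val, sysOp_val_zero, hu₀, smul_val, mul_inv_cancel_left₀ hc, sub_self]
  choose g hg using hdiv
  obtain ⟨w, hw⟩ := hsucc g
  refine ⟨(fun i => res h (u₀ i)) + fun i => tMul W' (w i), fun i => ?_⟩
  rw [map_add, Pi.add_apply, ← res_sysOp h ha,
    sysOp_tMul (fun i l s hs => (ha i l s hs).mono h), hw, ← res_tMul, ← hg, ← map_add,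
    add_sub_cancel]

lemma exists_sysOp_zero_eq_res (h : W' ≤ W) (hW : RayStable W)
    (ha : ∀ i l, ∀ s ∈ idx n m, DifferentiableOn ℂ (a i l s) W)
    (hp : ∀ k : ℕ, p.eval (k : ℂ) ≠ 0) (k : ℕ)
    (hk : ∀ f : Fin N → Hol W, ∃ u : Fin N → Hol W',
      ∀ i, sysOp a m p W' k u i = res h (f i)) (f : Fin N → Hol W) :
    ∃ u : Fin N → Hol W', ∀ i, sysOp a m p W' 0 u i = res h (f i) := by
  induction k with
  | zero => simpa using hk f
  | succ k ih =>
    refine ih fun f => exists_sysOp_eq_res_of_succ h hW ha k (hp k) ?_ f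
    simpa using hk

lemma tMul_injective : Function.Injective (tMul W) := by
  refine (injective_iff_map_eq_zero _).2 fun F hF => ext_on fun q hq => ?_
  have hne : ∀ y : ℂ × (Fin n → ℂ), y.1 ≠ 0 → F.1 y = 0 := fun y hy => by
    have := tMul_val F y
    rw [hF, zero_val] at this
    exact (mul_eq_zero.1 this.symm).resolve_left hy
  by_cases h0 : q.1 = 0
  · have hc : Tendsto (fun s : ℂ => F.1 (s, q.2)) (𝓝[≠] 0) (𝓝 (F.1 q)) := by
      have h1 : ContinuousAt (fun s : ℂ => F.1 (s, q.2)) 0 := by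
        refine ContinuousAt.comp' (g := F.1) ?_ (by fun_prop)
        rw [← h0]
        exact (diffAt F hq).continuousAt
      have h2 := h1.tendsto.mono_left (nhdsWithin_le_nhds (s := {0}ᶜ))
      rwa [← h0] at h2 ⊢
    refine tendsto_nhds_unique hc (tendsto_const_nhds.congr' ?_)
    filter_upwards [self_mem_nhdsWithin] with s hs
    exact (hne (s, q.2) hs).symm
  · exact hne q h0

lemma exists_eq_tMul_pow (hW : RayStable W)
    (ha : ∀ i l, ∀ s ∈ idx n m, DifferentiableOn ℂ (a i l s) W)
    (hp : ∀ k : ℕ, p.eval (k : ℂ) ≠ 0) {U : Fin N → Hol W} (hU : sysOp a m p W 0 U = 0) (k : ℕ) :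
    ∃ w : Fin N → Hol W, (∀ i, U i = (tMul W ^ k) (w i)) ∧ sysOp a m p W k w = 0 := by
  induction k with
  | zero => exact ⟨U, fun i => by simp, by simpa using hU⟩
  | succ k ih =>
    obtain ⟨w, hw, hw0⟩ := ih
    have hdiv : ∀ i, ∃ g, w i = tMul W g := fun i => exists_eq_tMul hW _ fun x _ => by
      have := sysOp_val_zero (a := a) (m := m) (p := p) k w i x
      rw [hw0] at this
      exact (mul_eq_zero.1 this.symm).resolve_left (hp k)
    choose g hg using hdiv
    refine ⟨g, fun i => by rw [hw, hg, pow_succ, Module.End.mul_apply], funext fun i => ?_⟩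
    apply tMul_injective
    rw [Nat.cast_succ, ← sysOp_tMul ha, ← funext hg, hw0]
    simp

lemma tMul_pow_val (k : ℕ) (F : Hol W) (q : ℂ × (Fin n → ℂ)) :
    ((tMul W ^ k) F).1 q = q.1 ^ k * F.1 q := by
  induction k with
  | zero => simp
  | succ k ih => rw [pow_succ', Module.End.mul_apply, tMul_val, ih, pow_succ', mul_assoc]

lemma eq_zero_of_sysOp_eq_zero (hW : RayStable W)
    (ha : ∀ i l, ∀ s ∈ idx n m, DifferentiableOn ℂ (a i l s) W)
    (hp : ∀ k : ℕ, p.eval (k : ℂ) ≠ 0) {U : Fin N → Hol W} (hU : sysOp a m p W 0 U = 0) :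
    U = 0 := by
  refine funext fun i => ext_on fun q hq => ?_
  set S : Set ℂ := (fun t => (t, q.2)) ⁻¹' W with hS
  have hSo : IsOpen S := W.isOpen.preimage (by fun_prop)
  have hstar : StarConvex ℝ 0 S := starConvex_zero_iff.2 fun t ht σ h0 h1 => by
    rw [Complex.real_smul]
    exact hW _ ht σ ⟨h0, h1⟩
  have h0S : (0 : ℂ) ∈ S := by simpa [hS] using hW q hq 0 (by simp)
  have hpre : IsPreconnected S := (hstar.isPathConnected h0S).isConnected.isPreconnected
  have han : ∀ F : Hol W, AnalyticOnNhd ℂ (fun t => F.1 (t, q.2)) S := fun F =>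
    DifferentiableOn.analyticOnNhd (fun t ht =>
      ((diffAt F ht).comp t (by fun_prop)).differentiableWithinAt) hSo
  have htop : analyticOrderAt (fun t => (U i).1 (t, q.2)) 0 = ⊤ := by
    refine ENat.eq_top_iff_forall_ge.2 fun k => ?_
    obtain ⟨w, hw, -⟩ := exists_eq_tMul_pow hW ha hp hU k
    refine (natCast_le_analyticOrderAt (han (U i) 0 h0S)).2
      ⟨fun t => (w i).1 (t, q.2), han (w i) 0 h0S, Eventually.of_forall fun t => ?_⟩
    rw [hw, tMul_pow_val, sub_zero, smul_eq_mul]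
  exact (han (U i)).eqOn_zero_of_preconnected_of_eventuallyEq_zero hpre h0S
    (analyticOrderAt_eq_top.1 htop) (show q.1 ∈ S from hq)

end Shift

section Compare

variable {n N : ℕ} {W : Opens (ℂ × (Fin n → ℂ))}

/-- The curried function `u` coincides with `F` on `W`. -/
def Agree (u : ℂ → (Fin n → ℂ) → ℂ) (F : Hol W) : Prop := ∀ q ∈ W, u q.1 q.2 = F.1 q

lemma Agree.thetaT {u : ℂ → (Fin n → ℂ) → ℂ} {F : Hol W} (h : Agree u F) :
    Agree (thetaT u) (euler W 0 F) := by
  intro q hq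
  have hcurve : HasDerivAt (fun t : ℂ => (t, q.2)) (1, 0) q.1 :=
    (hasDerivAt_id _).prodMk (hasDerivAt_const _ _)
  have hd := (diffAt F hq).hasFDerivAt.comp_hasDerivAt q.1 hcurve
  have heq : (fun t => u t q.2) =ᶠ[𝓝 q.1] F.1 ∘ fun t : ℂ => (t, q.2) := by
    filter_upwards [hcurve.continuousAt.preimage_mem_nhds (W.isOpen.mem_nhds hq)] with t ht
    exact h _ ht
  rw [_root_.thetaT, euler_val, zero_mul, add_zero, dir_val _ _ hq,
    (hd.congr_of_eventuallyEq heq).deriv]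

lemma Agree.thetaT_iterate {u : ℂ → (Fin n → ℂ) → ℂ} {F : Hol W} (h : Agree u F) (j : ℕ) :
    Agree (_root_.thetaT^[j] u) ((euler W 0 ^ j) F) := by
  induction j with
  | zero => simpa using h
  | succ j ih =>
    rw [Function.iterate_succ_apply', pow_succ', Module.End.mul_apply]
    exact ih.thetaT

lemma Agree.partialX {u : ℂ → (Fin n → ℂ) → ℂ} {F : Hol W} (h : Agree u F) (k : Fin n) :
    Agree (partialX k u) (dx W k F) := by
  intro q hq
  have hcurve : HasDerivAt (fun z : ℂ => (q.1, Function.update q.2 k z)) (0, Pi.single k 1)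
      (q.2 k) := (hasDerivAt_const _ _).prodMk (hasDerivAt_update _ _ _)
  have hval : ((q.1, Function.update q.2 k (q.2 k)) : ℂ × (Fin n → ℂ)) = q := by simp
  have hF := (diffAt F hq).hasFDerivAt
  have hd := HasFDerivAt.comp_hasDerivAt_of_eq (q.2 k) hF hcurve hval.symm
  have heq : (fun z => u q.1 (Function.update q.2 k z)) =ᶠ[𝓝 (q.2 k)]
      F.1 ∘ fun z : ℂ => (q.1, Function.update q.2 k z) := by
    filter_upwards [hcurve.continuousAt.preimage_mem_nhds
      (W.isOpen.mem_nhds (by rw [hval]; exact hq))] with z hz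
    exact h _ hz
  rw [_root_.partialX, dx, dir_val _ _ hq, (hd.congr_of_eventuallyEq heq).deriv]

lemma Agree.partialPow {u : ℂ → (Fin n → ℂ) → ℂ} {F : Hol W} (h : Agree u F) (α : Fin n → ℕ) :
    Agree (partialPow α u) (dxPow W α F) := by
  unfold _root_.partialPow dxPow
  induction List.finRange n with
  | nil => simpa using h
  | cons k l ih =>
    rw [List.foldr_cons, List.map_cons, List.prod_cons, Module.End.mul_apply]
    generalize α k = b
    induction b with
    | zero => simpa using ih
    | succ b ihb =>
      rw [Function.iterate_succ_apply', pow_succ', Module.End.mul_apply]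
      exact ihb.partialX k

lemma fuchsSysOp_eq {m : ℕ} {p : ℂ[X]}
    {a : Fin N → Fin N → (Fin n → ℕ) → ℕ → ℂ → (Fin n → ℂ) → ℂ}
    (ha : ∀ i l, ∀ s ∈ idx n m, DifferentiableOn ℂ (fun q : ℂ × _ => a i l s.2 s.1 q.1 q.2) W)
    {u : Fin N → ℂ → (Fin n → ℂ) → ℂ} {U : Fin N → Hol W} (h : ∀ i, Agree (u i) (U i))
    (i : Fin N) : Agree (fuchsSysOp m p a u i)
      (sysOp (fun i l s q => a i l s.2 s.1 q.1 q.2) m p W 0 U i) := by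
  intro q hq
  rw [fuchsSysOp, sysOp_apply, aeval_euler_apply, add_val, sum_val, sum_val, Finset.mul_sum]
  congr 1
  · refine Finset.sum_congr rfl fun j _ => ?_
    rw [smul_val, (h i).thetaT_iterate j q hq]
  · refine Finset.sum_congr rfl fun l _ => ?_
    rw [tMul_val, entry_apply, sum_val, idx, Finset.sum_filter, Finset.sum_product]
    congr 1
    refine Finset.sum_congr rfl fun j hj => Finset.sum_congr rfl fun α hα => ?_
    split_ifs with hle
    · have hs : (j, α) ∈ idx n m := Finset.mem_filter.2 ⟨Finset.mk_mem_product hj hα, hle⟩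
      rw [mul_val (ha i l (j, α) hs), ((h l).thetaT_iterate j).partialPow α q hq]
    · rfl

end Compare

section Existence

variable {n N : ℕ}

/-- The product of two open sets. -/
def prodOpens (ω : Opens ℂ) (Ω : Opens (Fin n → ℂ)) : Opens (ℂ × (Fin n → ℂ)) :=
  ⟨(ω : Set ℂ) ×ˢ (Ω : Set (Fin n → ℂ)), ω.isOpen.prod Ω.isOpen⟩

lemma prodOpens_mono (ω : Opens ℂ) {Ω Ω' : Opens (Fin n → ℂ)} (h : Ω ≤ Ω') :
    prodOpens ω Ω ≤ prodOpens ω Ω' := prod_mono_right (s := (ω : Set ℂ)) h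

lemma rayStable_prodOpens {ω : Opens ℂ} (hω : ∀ t ∈ ω, ∀ σ ∈ Icc (0 : ℝ) 1, (σ : ℂ) * t ∈ ω)
    (Ω : Opens (Fin n → ℂ)) : RayStable (prodOpens ω Ω) :=
  fun q hq σ hσ => ⟨hω q.1 hq.1 σ hσ, hq.2⟩

lemma res_res {W W' W'' : Opens (ℂ × (Fin n → ℂ))} (h : W' ≤ W) (h' : W'' ≤ W') (F : Hol W) :
    res h' (res h F) = res (h'.trans h) F :=
  ext_on fun q hq => by rw [res_val h' _ hq, res_val h _ (h' hq), res_val _ _ hq]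

/-- A compact subset of a star-shaped set has a compact star-shaped hull. -/
lemma exists_compact_hull {ω : Opens ℂ} (hω : ∀ t ∈ ω, ∀ σ ∈ Icc (0 : ℝ) 1, (σ : ℂ) * t ∈ ω)
    {B : Set ℂ} (hB : IsCompact B) (hBω : B ⊆ ω) :
    ∃ K, IsCompact K ∧ B ⊆ K ∧ K ⊆ ω ∧ ∀ t ∈ K, ∀ σ ∈ Icc (0 : ℝ) 1, (σ : ℂ) * t ∈ K := by
  refine ⟨(fun z : ℝ × ℂ => (z.1 : ℂ) * z.2) '' (Icc (0 : ℝ) 1 ×ˢ B),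
    (isCompact_Icc.prod hB).image (by fun_prop), fun t ht => ⟨(1, t), ⟨by simp, ht⟩, by simp⟩,
    ?_, ?_⟩
  · rintro _ ⟨⟨σ, t⟩, ⟨hσ, ht⟩, rfl⟩
    exact hω t (hBω ht) σ hσ
  · rintro _ ⟨⟨τ, t⟩, ⟨hτ, ht⟩, rfl⟩ σ hσ
    refine ⟨(σ * τ, t), ⟨⟨mul_nonneg hσ.1 hτ.1, mul_le_one₀ hσ.2 hτ.1 hτ.2⟩, ht⟩, ?_⟩
    push_cast
    ring

lemma exists_shifted_radius {m : ℕ} {p : ℂ[X]} (hmonic : p.Monic) (hdeg : p.natDegree = m)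
    {ρ₁ : ℝ} (hρ₁ : 0 < ρ₁) {Ω Ω₁ : Opens (Fin n → ℂ)}
    (hΩb : Bornology.IsBounded (Ω : Set (Fin n → ℂ)))
    (hcl : closure (Ω : Set (Fin n → ℂ)) ⊆ Ω₁)
    {a : Fin N → Fin N → ℕ × (Fin n → ℕ) → ℂ × (Fin n → ℂ) → ℂ}
    (ha : ∀ i l, ∀ s ∈ idx n m, DifferentiableOn ℂ (a i l s) (ball (0 : ℂ) ρ₁ ×ˢ Ω₁)) :
    ∃ k : ℕ, ∃ ρ : ℝ, 0 < ρ ∧ ρ < ρ₁ ∧ ∀ (ω : Opens ℂ), (ω : Set ℂ) ⊆ ball 0 ρ →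
      (∀ t ∈ ω, ∀ σ ∈ Icc (0 : ℝ) 1, (σ : ℂ) * t ∈ ω) →
      ∀ (h : prodOpens ω Ω ≤ prodOpens ω Ω₁) (f : Fin N → Hol (prodOpens ω Ω₁)),
        ∃ u : Fin N → Hol (prodOpens ω Ω),
          ∀ i, sysOp a m p (prodOpens ω Ω) k u i = res h (f i) := by
  set L := p.roots.toList with hL
  have hLm : L.length = m := by
    rw [hL, Multiset.length_toList, IsAlgClosed.card_roots_eq_natDegree, hdeg]
  have hp : p = (L.map fun z => X - C z).prod := by
    rw [← Multiset.prod_coe, ← Multiset.map_coe, hL, Multiset.coe_toList]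
    exact (prod_multiset_X_sub_C_of_monic_of_roots_card_eq hmonic
      IsAlgClosed.card_roots_eq_natDegree).symm
  have hnonneg : ∀ y ∈ L.map (norm : ℂ → ℝ), 0 ≤ y := fun y hy => by
    obtain ⟨z, -, rfl⟩ := List.mem_map.1 hy
    exact norm_nonneg z
  obtain ⟨Λ, hΛ0, hΛ⟩ : ∃ Λ : ℝ, 0 ≤ Λ ∧ ∀ z ∈ L, ‖z‖ ≤ Λ :=
    ⟨(L.map norm).sum, List.sum_nonneg hnonneg, fun z hz =>
      List.single_le_sum hnonneg _ (List.mem_map_of_mem hz)⟩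
  obtain ⟨k, hk⟩ := exists_nat_gt (Λ + 1)
  have hLk : ∀ z ∈ L, 0 < ((k : ℂ) - z - 1).re ∧ ‖z‖ ≤ Λ := fun z hz => by
    refine ⟨?_, hΛ z hz⟩
    have := (Complex.re_le_norm z).trans (hΛ z hz)
    simp
    linarith
  obtain ⟨δ₀, hδ₀, hsub⟩ :=
    hΩb.isCompact_closure.exists_cthickening_subset_open Ω₁.isOpen hcl
  have hcpt : IsCompact (cthickening δ₀ (closure (Ω : Set (Fin n → ℂ)))) :=
    hΩb.isCompact_closure.cthickening
  set Ω' : Opens (Fin n → ℂ) :=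
    ⟨thickening δ₀ (closure (Ω : Set (Fin n → ℂ))), isOpen_thickening⟩ with hΩ'
  have hΩ'c : (Ω' : Set (Fin n → ℂ)) ⊆ cthickening δ₀ (closure (Ω : Set (Fin n → ℂ))) :=
    thickening_subset_cthickening _ _
  have hΩΩ' : Ω ≤ Ω' := subset_closure.trans (self_subset_thickening hδ₀ _)
  have hΩ'Ω₁ : Ω' ≤ Ω₁ := hΩ'c.trans hsub
  set δ : ℝ := min (δ₀ / 2) 1 with hδ
  have hδpos : 0 < δ := lt_min (half_pos hδ₀) one_pos
  have hδ1 : δ ≤ 1 := min_le_right _ _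
  have hball : ∀ x ∈ Ω, closedBall x δ ⊆ (Ω' : Set (Fin n → ℂ)) := fun x hx =>
    ((closedBall_subset_ball ((min_le_left _ _).trans_lt (half_lt_self hδ₀))).trans
      (ball_subset_thickening (subset_closure hx) _))
  obtain ⟨A, hA⟩ := ((isCompact_closedBall (0 : ℂ) (ρ₁ / 2)).prod hcpt).exists_bound_of_continuousOn
    (f := fun q => fun (i l : Fin N) (s : idx n m) => a i l s q)
    (continuousOn_pi.2 fun i => continuousOn_pi.2 fun l => continuousOn_pi.2 fun s =>
      (ha i l s s.2).continuousOn.mono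
        (prod_mono (closedBall_subset_ball (half_lt_self hρ₁)) hsub))
  obtain ⟨C₀, hC₀⟩ : ∃ C₀ : ℝ, C₀ = N * ((idx n m).card * (max A 0 * ((3 * (m + 2)) ^ m * (1 + Λ) ^ m))) := ⟨_, rfl⟩
  have hA0 : 0 ≤ max A 0 := le_max_right _ _
  have hC : 0 ≤ C₀ := hC₀ ▸ mul_nonneg (Nat.cast_nonneg _) (mul_nonneg (Nat.cast_nonneg _)
    (mul_nonneg hA0 (mul_nonneg (by positivity) (pow_nonneg (by linarith) _))))
  clear_value δ
  refine ⟨k, min (ρ₁ / 2) (δ ^ m / (2 * (C₀ + 1))), lt_min (half_pos hρ₁) (by positivity),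
    (min_le_left _ _).trans_lt (half_lt_self hρ₁), fun ω hωρ hω h f => ?_⟩
  have hW : prodOpens ω Ω' ≤ prodOpens ω Ω₁ := prodOpens_mono ω hΩ'Ω₁
  have hW' : prodOpens ω Ω ≤ prodOpens ω Ω' := prodOpens_mono ω hΩΩ'
  have hωle : ∀ t ∈ ω, ‖t‖ < min (ρ₁ / 2) (δ ^ m / (2 * (C₀ + 1))) := fun t ht =>
    mem_ball_zero_iff.1 (hωρ ht)
  have hcoef : ∀ i l, ∀ s ∈ idx n m, ∀ q ∈ prodOpens ω Ω', ‖a i l s q‖ ≤ max A 0 := by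
    intro i l s hs q hq
    have h1 := hA q ⟨mem_closedBall_zero_iff.2 ((hωle _ hq.1).le.trans (min_le_left _ _)),
      hΩ'c hq.2⟩
    have h2 := (norm_le_pi_norm (fun s : idx n m => a i l s q) ⟨s, hs⟩)
    have h3 := (norm_le_pi_norm (fun (l : Fin N) (s : idx n m) => a i l s q) l)
    have h4 := (norm_le_pi_norm (fun (i l : Fin N) (s : idx n m) => a i l s q) i)
    exact (h2.trans (h3.trans (h4.trans h1))).trans (le_max_left _ _)
  have hdom : ((prodOpens ω Ω' : Opens _) : Set (ℂ × (Fin n → ℂ))) ⊆ ball (0 : ℂ) ρ₁ ×ˢ Ω₁ :=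
    prod_mono (fun t ht => mem_ball_zero_iff.2
      (((hωle t ht).trans_le (min_le_left _ _)).trans (half_lt_self hρ₁))) hΩ'Ω₁
  refine (exists_sysOp_eq_res hW' (rayStable_prodOpens hω Ω') k hΛ0 hA0 hδpos
    hδ1 L hp hLm hLk (fun i l s hs => (ha i l s hs).mono hdom) hcoef
    (fun i => res hW (f i)) ?_).imp fun u hu i => by rw [hu, res_res]
  intro q hq
  obtain ⟨r₁, hr₁, hr₁ω⟩ := nhds_basis_closedBall.mem_iff.1 (ω.isOpen.mem_nhds hq.1)
  obtain ⟨r₂, hr₂, hr₂Ω⟩ := Metric.isOpen_iff.1 (prodOpens ω Ω).isOpen q hq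
  obtain ⟨K, hK, hBK, hKω, hKray⟩ := exists_compact_hull hω (isCompact_closedBall q.1 r₁) hr₁ω
  obtain ⟨M, hM⟩ := (hK.prod hcpt).exists_bound_of_continuousOn
    (f := fun q => fun i => (f i).1 q)
    (continuousOn_pi.2 fun i => (diffOn (f i)).continuousOn.mono (prod_mono hKω hsub))
  refine ⟨min r₁ r₂, lt_min hr₁ hr₂, (ball_subset_ball (min_le_right _ _)).trans hr₂Ω, K, max M 0,
    le_max_right _ _, hKray, fun t ht => ?_, fun y hy => ⟨?_, ?_⟩, ?_⟩
  · have h1 : ‖t‖ ≤ δ ^ m / (2 * (C₀ + 1)) := (hωle t (hKω ht)).le.trans (min_le_right _ _)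
    rw [← hC₀]
    calc C₀ * ‖t‖ ≤ (C₀ + 1) * (δ ^ m / (2 * (C₀ + 1))) := by gcongr; linarith
      _ = 1 / 2 * δ ^ m := by field_simp
  · refine hBK (ball_subset_closedBall ?_)
    rw [mem_ball] at hy ⊢
    exact ((le_max_left _ _).trans_lt (Prod.dist_eq (x := y) (y := q) ▸ hy)).trans_le
      (min_le_left _ _)
  · exact prod_mono hKω (hball _ (hr₂Ω (ball_subset_ball (min_le_right _ _) hy)).2)
  · intro i t ht x s hs hs1 hKW
    have hq : (t, x) ∈ prodOpens ω Ω' := hKW ⟨ht, mem_closedBall_self hs.le⟩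
    rw [res_val hW _ hq, pow_zero, pow_zero, mul_one, div_one]
    exact ((norm_le_pi_norm (fun i => (f i).1 (t, x)) i).trans (hM _ ⟨ht, hΩ'c hq.2⟩)).trans
      (le_max_left _ _)

end Existence

end Hol

end SolvabilityProof

/-- Existence and uniqueness of holomorphic solutions of the `N×N`-system version of
Fuchsian type equations `Pu = f`, with scalar indicial polynomial `p` having no
non-negative integer characteristic exponent. -/
theorem statement6 (m n N : ℕ) (hm : 1 ≤ m) (hN : 1 ≤ N) (ρ₁ : ℝ) (hρ₁ : 0 < ρ₁)
    (Ω Ω₁ : Set (Fin n → ℂ)) (hΩ : IsOpen Ω) (hΩb : Bornology.IsBounded Ω)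
    (hΩ₁ : IsOpen Ω₁) (hcl : closure Ω ⊆ Ω₁)
    (p : Polynomial ℂ) (hmonic : p.Monic) (hdeg : p.natDegree = m)
    (hchar : ∀ k : ℕ, p.eval (k : ℂ) ≠ 0)
    (a : Fin N → Fin N → (Fin n → ℕ) → ℕ → ℂ → (Fin n → ℂ) → ℂ)
    (ha : ∀ (i l : Fin N) (α : Fin n → ℕ) (j : ℕ), (∑ k, α k) + j ≤ m →
      DifferentiableOn ℂ (fun q : ℂ × (Fin n → ℂ) => a i l α j q.1 q.2)
        ((Metric.ball (0 : ℂ) ρ₁) ×ˢ Ω₁)) :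
    ∃ ρ : ℝ, 0 < ρ ∧ ρ < ρ₁ ∧
      ∀ ω : Set ℂ, IsOpen ω → ω ⊆ Metric.ball (0 : ℂ) ρ →
        (∀ t ∈ ω, ∀ σ : ℝ, 0 ≤ σ → σ ≤ 1 → (σ : ℂ) * t ∈ ω) →
        ∀ f : Fin N → ℂ → (Fin n → ℂ) → ℂ,
          (∀ i, DifferentiableOn ℂ (fun q : ℂ × (Fin n → ℂ) => f i q.1 q.2) (ω ×ˢ Ω₁)) →
          ∃ u : Fin N → ℂ → (Fin n → ℂ) → ℂ,
            ((∀ i, DifferentiableOn ℂ (fun q : ℂ × (Fin n → ℂ) => u i q.1 q.2) (ω ×ˢ Ω)) ∧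
              ∀ i, ∀ t ∈ ω, ∀ x ∈ Ω, fuchsSysOp m p a u i t x = f i t x) ∧
            ∀ v : Fin N → ℂ → (Fin n → ℂ) → ℂ,
              ((∀ i, DifferentiableOn ℂ (fun q : ℂ × (Fin n → ℂ) => v i q.1 q.2) (ω ×ˢ Ω)) ∧
                ∀ i, ∀ t ∈ ω, ∀ x ∈ Ω, fuchsSysOp m p a v i t x = f i t x) →
              ∀ i, ∀ t ∈ ω, ∀ x ∈ Ω, v i t x = u i t x := by
  set Ωo : TopologicalSpace.Opens (Fin n → ℂ) := ⟨Ω, hΩ⟩ with hΩo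
  set Ω₁o : TopologicalSpace.Opens (Fin n → ℂ) := ⟨Ω₁, hΩ₁⟩ with hΩ₁o
  have hle : Ωo ≤ Ω₁o := subset_closure.trans hcl
  obtain ⟨k, ρ, hρ, hρ', hex⟩ := Hol.exists_shifted_radius (Ω := Ωo) (Ω₁ := Ω₁o)
    (a := fun i l s q => a i l s.2 s.1 q.1 q.2) hmonic hdeg hρ₁ hΩb hcl
    fun i l s hs => ha i l s.2 s.1 (Hol.le_of_mem_idx hs)
  refine ⟨ρ, hρ, hρ', fun ω hω hωρ hstar f hf => ?_⟩
  set ωo : TopologicalSpace.Opens ℂ := ⟨ω, hω⟩ with hωo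
  have hstar' : ∀ t ∈ ωo, ∀ σ ∈ Set.Icc (0 : ℝ) 1, (σ : ℂ) * t ∈ ωo := fun t ht σ hσ =>
    hstar t ht σ hσ.1 hσ.2
  have hcoef : ∀ i l, ∀ s ∈ Hol.idx n m,
      DifferentiableOn ℂ (fun q : ℂ × (Fin n → ℂ) => a i l s.2 s.1 q.1 q.2)
        (Hol.prodOpens ωo Ω₁o) := fun i l s hs =>
    (ha i l s.2 s.1 (Hol.le_of_mem_idx hs)).mono (Set.prod_mono
      (hωρ.trans (Metric.ball_subset_ball hρ'.le)) subset_rfl)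
  have hW := Hol.prodOpens_mono ωo hle
  obtain ⟨U, hU⟩ := Hol.exists_sysOp_zero_eq_res hW (Hol.rayStable_prodOpens hstar' Ω₁o) hcoef
    hchar k (hex ωo hωρ hstar' hW) fun i => Hol.ofFun _ (hf i)
  have hcoef' := fun i l s hs => (hcoef i l s hs).mono hW
  have hUf : ∀ i, ∀ q ∈ Hol.prodOpens ωo Ωo, (Hol.sysOp (fun i l s q => a i l s.2 s.1 q.1 q.2) m p
      (Hol.prodOpens ωo Ωo) 0 U i).1 q = f i q.1 q.2 := fun i q hq => by
    rw [hU, Hol.res_val hW _ hq, Hol.ofFun_val (hf i) (hW hq)]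
  refine ⟨fun i t x => (U i).1 (t, x), ⟨fun i => Hol.diffOn (U i), fun i t ht x hx => ?_⟩,
    fun v ⟨hv, hvf⟩ i t ht x hx => ?_⟩
  · rw [← hUf i (t, x) ⟨ht, hx⟩]
    exact Hol.fuchsSysOp_eq hcoef' (fun i q _ => rfl) i (t, x) ⟨ht, hx⟩
  · set V : Fin N → Hol (Hol.prodOpens ωo Ωo) := fun i => Hol.ofFun _ (hv i) with hV
    have hagree : ∀ i, Hol.Agree (v i) (V i) := fun i q hq => (Hol.ofFun_val (hv i) hq).symm
    have hVU : Hol.sysOp (fun i l s q => a i l s.2 s.1 q.1 q.2) m p (Hol.prodOpens ωo Ωo) 0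
        (V - U) = 0 := by
      refine funext fun i => Hol.ext_on fun q hq => ?_
      rw [map_sub, Pi.sub_apply, Hol.sub_val, hUf i q hq,
        ← Hol.fuchsSysOp_eq hcoef' hagree i q hq, hvf i q.1 hq.1 q.2 hq.2, sub_self]
      rfl
    have h0 := Hol.eq_zero_of_sysOp_eq_zero (Hol.rayStable_prodOpens hstar' Ωo) hcoef' hchar hVU
    rw [← sub_eq_zero.1 h0]
    exact hagree i (t, x) ⟨ht, hx⟩
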